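/- arXiv:1306.1759 — 2 statements merged into one kernel-verified Lean document; each statement's English description precedes it below -/
import Mathlib

section
/- Let S̃ be the universal cover of a closed e.s.c.s. S with all cone angles > 2π. Let [x₀,y₀] be a geodesic segment containing a conical point s in its interior, and assume that both angles subtended at s by [x₀,s] and [s,y₀] are strictly greater than π, say θ₁ + π and θ₂ + π with θ₁ + θ₂ + 2π = θ(s). Then there exists ε > 0 such that for all points x, y with d(x,x₀) < ε and d(y,y₀) < ε, every geodesic segment [x,y] contains s. -/
open Metric Real Set

noncomputable section

/-- Distance between two angular coordinates in `ℝ / θℤ`. -/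
def circleDist (θ t₁ t₂ : ℝ) : ℝ := |(t₁ - t₂) - θ * round ((t₁ - t₂) / θ)|

/-- Distance on the standard Euclidean cone `C(v,θ)` of cone angle `θ`;
a point `(r,t)` has radial coordinate `r ≥ 0` and angular coordinate `t ∈ ℝ/θℤ`. -/
noncomputable def coneDist (θ : ℝ) (p q : ℝ × ℝ) : ℝ :=
  if Real.pi ≤ circleDist θ p.2 q.2 then p.1 + q.1
  else Real.sqrt (p.1 ^ 2 + q.1 ^ 2 - 2 * p.1 * q.1 * Real.cos (circleDist θ p.2 q.2))

/-- `x` has a neighborhood isometric to a disk in the Euclidean plane. -/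
def IsRegularPoint {S : Type*} [MetricSpace S] (x : S) : Prop :=
  ∃ ε > 0, ∃ f : S → EuclideanSpace ℝ (Fin 2),
    (∀ p ∈ ball x ε, ∀ q ∈ ball x ε, dist (f p) (f q) = dist p q) ∧
    f '' ball x ε = ball (f x) ε

/-- `x` has a neighborhood isometric to a neighborhood of the vertex of the
standard cone `C(v,θ)`. -/
def IsConicalPoint {S : Type*} [MetricSpace S] (θ : ℝ) (x : S) : Prop :=
  ∃ ε > 0, ∃ f : S → ℝ × ℝ,
    f x = (0, 0) ∧
    (∀ p ∈ ball x ε, 0 ≤ (f p).1 ∧ (f p).1 < ε) ∧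
    (∀ p ∈ ball x ε, ∀ q ∈ ball x ε, coneDist θ (f p) (f q) = dist p q) ∧
    (∀ r t : ℝ, 0 ≤ r → r < ε → ∃ p ∈ ball x ε, coneDist θ (f p) (r, t) = 0)

/-- The length of a path, as total variation. -/
noncomputable def pathLength {S : Type*} [MetricSpace S] {x y : S} (γ : Path x y) : ENNReal :=
  eVariationOn (fun t => γ t) Set.univ

/-- The metric is a length metric: the distance between two points is the infimum
of lengths of paths joining them. -/
def IsLengthSpace (S : Type*) [MetricSpace S] : Prop :=
  ∀ x y : S, edist x y = ⨅ γ : Path x y, pathLength γ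

/-- A Euclidean surface with conical singularities: a space with a length metric,
a finite set of conical points of prescribed positive angles, all other points
having Euclidean disk neighborhoods. -/
structure ESCS (S : Type*) [MetricSpace S] where
  conePts : Finset S
  angle : S → ℝ
  angle_pos : ∀ s ∈ conePts, 0 < angle s
  lengthMetric : IsLengthSpace S
  regular : ∀ x : S, x ∉ conePts → IsRegularPoint x
  conical : ∀ s ∈ conePts, IsConicalPoint (angle s) s

/-- All cone angles are `> 2π`. -/
def ESCS.BigAngles {S : Type*} [MetricSpace S] (E : ESCS S) : Prop :=
  ∀ s ∈ E.conePts, 2 * Real.pi < E.angle s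

/-- For closed orientable surfaces, genus `≥ 2` is equivalent to the fundamental
group being non-abelian. -/
def GenusAtLeastTwo (S : Type*) [TopologicalSpace S] : Prop :=
  ∃ (x : S) (a b : FundamentalGroup S x), a * b ≠ b * a

/-- A (globally) geodesic line: an isometric map `ℝ → X`. -/
def IsGeodesicLine {X : Type*} [MetricSpace X] (c : ℝ → X) : Prop :=
  ∀ s t : ℝ, dist (c s) (c t) = |s - t|

/-- A geodesic ray, recorded as a map `ℝ → X` which is isometric on `[0,∞)`
and constant on `(-∞,0]`. -/
def IsRay {X : Type*} [MetricSpace X] (r : ℝ → X) : Prop :=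
  (∀ s t : ℝ, 0 ≤ s → 0 ≤ t → dist (r s) (r t) = |s - t|) ∧ ∀ t ≤ 0, r t = r 0

abbrev RaySpace (X : Type*) [MetricSpace X] := {r : ℝ → X // IsRay r}

/-- Two geodesic rays are asymptotic when they are at bounded distance. -/
instance raySetoid (X : Type*) [MetricSpace X] : Setoid (RaySpace X) where
  r r₁ r₂ := ∃ C : ℝ, ∀ t : ℝ, 0 ≤ t → dist (r₁.1 t) (r₂.1 t) ≤ C
  iseqv := by
    constructor
    · intro r; exact ⟨0, fun t ht => by simp⟩
    · rintro r₁ r₂ ⟨C, hC⟩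
      exact ⟨C, fun t ht => by rw [dist_comm]; exact hC t ht⟩
    · rintro r₁ r₂ r₃ ⟨C₁, h₁⟩ ⟨C₂, h₂⟩
      exact ⟨C₁ + C₂, fun t ht =>
        (dist_triangle _ (r₂.1 t) _).trans (add_le_add (h₁ t ht) (h₂ t ht))⟩

/-- The visual boundary: asymptoty classes of geodesic rays, with the quotient
of the topology of (locally) uniform convergence of rays. -/
abbrev Boundary (X : Type*) [MetricSpace X] := Quotient (raySetoid X)

/-- The forward ray of a geodesic line. -/
def posRay {X : Type*} [MetricSpace X] (c : ℝ → X) (hc : IsGeodesicLine c) : RaySpace X :=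
  ⟨fun t => c (max t 0),
   ⟨fun s t hs ht => by
      show dist (c (max s 0)) (c (max t 0)) = |s - t|
      rw [max_eq_left hs, max_eq_left ht]; exact hc s t,
    fun t ht => by
      show c (max t 0) = c (max 0 0)
      rw [max_eq_right ht, max_self]⟩⟩

/-- The backward ray of a geodesic line. -/
def negRay {X : Type*} [MetricSpace X] (c : ℝ → X) (hc : IsGeodesicLine c) : RaySpace X :=
  ⟨fun t => c (-(max t 0)),
   ⟨fun s t hs ht => by
      show dist (c (-(max s 0))) (c (-(max t 0))) = |s - t|
      rw [max_eq_left hs, max_eq_left ht, hc, neg_sub_neg, abs_sub_comm],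
    fun t ht => by
      show c (-(max t 0)) = c (-(max 0 0))
      rw [max_eq_right ht, max_self]⟩⟩

/-- An isometry maps geodesic rays to geodesic rays. -/
def mapRay {X : Type*} [MetricSpace X] (φ : X ≃ᵢ X) (r : RaySpace X) : RaySpace X :=
  ⟨fun t => φ (r.1 t),
   ⟨fun s t hs ht => by rw [φ.isometry.dist_eq]; exact r.2.1 s t hs ht,
    fun t ht => by
      show φ (r.1 t) = φ (r.1 0)
      rw [r.2.2 t ht]⟩⟩

/-- The induced action of an isometry on the visual boundary. -/
def boundaryMap {X : Type*} [MetricSpace X] (φ : X ≃ᵢ X) : Boundary X → Boundary X :=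
  Quotient.map (mapRay φ) (by
    rintro r₁ r₂ ⟨C, hC⟩
    exact ⟨C, fun t ht => by
      show dist (φ (r₁.1 t)) (φ (r₂.1 t)) ≤ C
      rw [φ.isometry.dist_eq]; exact hC t ht⟩)

/-- The group of deck transformations of a covering `p : X → S`, acting by isometries. -/
def deckGroup {X S : Type*} [MetricSpace X] [MetricSpace S] (p : X → S) :
    Subgroup (X ≃ᵢ X) where
  carrier := {φ : X ≃ᵢ X | ∀ x, p (φ x) = p x}
  one_mem' := fun x => rfl
  mul_mem' := by
    intro a b ha hb x
    show p (a (b x)) = p x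
    rw [ha, hb]
  inv_mem' := by
    intro a ha x
    show p (a.symm x) = p x
    have h := ha (a.symm x)
    rw [a.apply_symm_apply] at h
    exact h.symm

/-- A hyperbolic (axial) isometry: it translates some geodesic line. -/
def IsAxial {X : Type*} [MetricSpace X] (φ : X ≃ᵢ X) : Prop :=
  ∃ c : ℝ → X, IsGeodesicLine c ∧ ∃ T : ℝ, 0 < T ∧ ∀ t : ℝ, φ (c t) = c (t + T)

/-- A local isometry between metric spaces. -/
def IsLocalIsometry {X S : Type*} [MetricSpace X] [MetricSpace S] (p : X → S) : Prop :=
  ∀ x : X, ∃ ε > 0, ∀ y ∈ ball x ε, ∀ z ∈ ball x ε, dist (p y) (p z) = dist y z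

/-- The universal covering of `S`: a simply connected space `X` with a covering
projection which is a local isometry. -/
structure UnivCover (X S : Type*) [MetricSpace X] [MetricSpace S] where
  p : X → S
  covering : IsCoveringMap p
  localIso : IsLocalIsometry p
  simplyConnected : SimplyConnectedSpace X

/-- `g` is a local isometric map near `t`. -/
def IsLocalGeodesicAt {S : Type*} [MetricSpace S] (g : ℝ → S) (t : ℝ) : Prop :=
  ∃ ε > 0, ∀ s u : ℝ, |s - t| < ε → |u - t| < ε → dist (g s) (g u) = |s - u|

/-- A geodesic in `S`: a local isometric map `ℝ → S`. -/
def IsLocalGeodesic {S : Type*} [MetricSpace S] (g : ℝ → S) : Prop :=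
  ∀ t : ℝ, IsLocalGeodesicAt g t

/-- A local isometric map on a subset of `ℝ` (geodesic ray for `A = [0,∞)`,
geodesic segment for `A = [a,b]`). -/
def IsLocalGeodesicOn {S : Type*} [MetricSpace S] (g : ℝ → S) (A : Set ℝ) : Prop :=
  ∀ t ∈ A, ∃ ε > 0, ∀ s ∈ A, ∀ u ∈ A, |s - t| < ε → |u - t| < ε → dist (g s) (g u) = |s - u|

/-- A closed geodesic: a periodic local isometric map `ℝ → S`. -/
def IsClosedGeodesic {S : Type*} [MetricSpace S] (g : ℝ → S) : Prop :=
  IsLocalGeodesic g ∧ ∃ T : ℝ, 0 < T ∧ Function.Periodic g T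

/-- Euclidean distance on `ℝ × ℝ`. -/
noncomputable def eudist (p q : ℝ × ℝ) : ℝ :=
  Real.sqrt ((p.1 - q.1) ^ 2 + (p.2 - q.2) ^ 2)

/-- `F` is an isometry from `D ⊂ ℝ²` (with the Euclidean metric) onto its image. -/
def IsStripChart {X : Type*} [MetricSpace X] (D : Set (ℝ × ℝ)) (F : ℝ × ℝ → X) : Prop :=
  ∀ p ∈ D, ∀ q ∈ D, dist (F p) (F q) = eudist p q

def stripDom (ε : ℝ) : Set (ℝ × ℝ) := Set.Icc 0 ε ×ˢ (Set.univ : Set ℝ)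
def halfStripDom (ε : ℝ) : Set (ℝ × ℝ) := Set.Icc 0 ε ×ˢ Set.Ici (0 : ℝ)
def rectDom (w l : ℝ) : Set (ℝ × ℝ) := Set.Icc 0 w ×ˢ Set.Icc 0 l

/-- A right-angle quadrangle of width `w` and length `l`: a subset isometric to
the Euclidean rectangle `[0,w] × [0,l]`. -/
def IsRectangle {X : Type*} [MetricSpace X] (w l : ℝ) (A : Set X) : Prop :=
  ∃ F : ℝ × ℝ → X, IsStripChart (rectDom w l) F ∧ F '' rectDom w l = A

/-- A geodesic ray `g` in `S` lies in a flat half strip of width `ε`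
(`g ∈ FHS(ε)`): some lift of `g` to the universal cover is one of the rays of a
flat half strip of width `ε`. -/
def RayInFHS {X S : Type*} [MetricSpace X] [MetricSpace S] (U : UnivCover X S)
    (ε : ℝ) (g : ℝ → S) : Prop :=
  ∃ (gt : ℝ → X) (F : ℝ × ℝ → X) (r : ℝ),
    (∀ t : ℝ, 0 ≤ t → U.p (gt t) = g t) ∧
    IsStripChart (halfStripDom ε) F ∧ r ∈ Set.Icc 0 ε ∧ ∀ t : ℝ, 0 ≤ t → gt t = F (r, t)

/-- A geodesic segment `g : [0,L] → S` lies in a flat half strip of width `ε`. -/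
def SegInFHS {X S : Type*} [MetricSpace X] [MetricSpace S] (U : UnivCover X S)
    (ε L : ℝ) (g : ℝ → S) : Prop :=
  ∃ (gt : ℝ → X) (F : ℝ × ℝ → X) (r : ℝ),
    (∀ t ∈ Set.Icc 0 L, U.p (gt t) = g t) ∧
    IsStripChart (halfStripDom ε) F ∧ r ∈ Set.Icc 0 ε ∧ ∀ t ∈ Set.Icc 0 L, gt t = F (r, t)

/-- A closed piece-wise geodesic: a periodic closed curve which is a local
geodesic except possibly where it meets the conical points of angle `< 2π`. -/
def IsClosedPiecewiseGeodesic {S : Type*} [MetricSpace S] (E : ESCS S) (γ : ℝ → S) : Prop :=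
  Continuous γ ∧ (∃ T : ℝ, 0 < T ∧ Function.Periodic γ T) ∧
  ∀ t : ℝ, ¬(γ t ∈ E.conePts ∧ E.angle (γ t) < 2 * Real.pi) → IsLocalGeodesicAt γ t

/-- A generalized saddle connection: a local geodesic segment whose endpoints are
conical points of angle `< 2π`, whose interior contains no such points. -/
def IsGenSaddleConnection {S : Type*} [MetricSpace S] (E : ESCS S) (σ : ℝ → S)
    (a b : ℝ) : Prop :=
  a < b ∧ IsLocalGeodesicOn σ (Set.Icc a b) ∧
  σ a ∈ E.conePts ∧ E.angle (σ a) < 2 * Real.pi ∧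
  σ b ∈ E.conePts ∧ E.angle (σ b) < 2 * Real.pi ∧
  ∀ t ∈ Set.Ioo a b, ¬(σ t ∈ E.conePts ∧ E.angle (σ t) < 2 * Real.pi)

/-- The loop obtained by restricting `g` to `[t₁,t₂]` when `g t₂ = g t₁`. -/
def loopOf {S : Type*} [MetricSpace S] {g : ℝ → S} (hg : Continuous g) (t₁ t₂ : ℝ)
    (h : g t₂ = g t₁) : Path (g t₁) (g t₁) where
  toFun := fun u => g (t₁ + (u : ℝ) * (t₂ - t₁))
  continuous_toFun := hg.comp (by fun_prop)
  source' := by simp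
  target' := by
    have h1 : t₁ + ((1 : unitInterval) : ℝ) * (t₂ - t₁) = t₂ := by norm_num
    show g (t₁ + ((1 : unitInterval) : ℝ) * (t₂ - t₁)) = g t₁
    rw [h1, h]

/-- `g` has a homotopically trivial self intersection. -/
def HasTrivialSelfIntersection {S : Type*} [MetricSpace S] {g : ℝ → S}
    (hg : Continuous g) : Prop :=
  ∃ t₁ t₂ : ℝ, t₁ < t₂ ∧ ∃ h : g t₂ = g t₁,
    (loopOf hg t₁ t₂ h).Homotopic (Path.refl (g t₁))

/-- The orbit `{t·g : t ∈ ℝ}` of a geodesic under the geodesic flow, inside the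
space `GS` of geodesics with the compact-open topology. -/
def translates {S : Type*} [MetricSpace S] (g : C(ℝ, S)) :
    Set {γ : C(ℝ, S) // IsLocalGeodesic ⇑γ} :=
  {β | ∃ t : ℝ, ∀ s : ℝ, β.1 s = g (t + s)}

lemma circleDist_nonneg (θ a b : ℝ) : 0 ≤ circleDist θ a b := abs_nonneg _

lemma exists_circleDist_eq (θ a b : ℝ) : ∃ k : ℤ, circleDist θ a b = |a - b - θ * k| :=
  ⟨round ((a - b) / θ), rfl⟩

lemma circleDist_le {θ : ℝ} (hθ : 0 < θ) (a b : ℝ) (k : ℤ) :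
    circleDist θ a b ≤ |a - b - θ * k| := by
  have h := round_le ((a - b) / θ) k
  have e : ∀ z : ℤ, |a - b - θ * z| = θ * |(a - b) / θ - z| := by
    intro z
    rw [← abs_of_pos hθ, ← abs_mul, abs_of_pos hθ]
    congr 1
    field_simp
  rw [circleDist, e, e]
  exact mul_le_mul_of_nonneg_left h hθ.le

lemma circleDist_triangle {θ : ℝ} (hθ : 0 < θ) (a b c : ℝ) :
    circleDist θ a c ≤ circleDist θ a b + circleDist θ b c := by
  obtain ⟨k, hk⟩ := exists_circleDist_eq θ a b
  obtain ⟨l, hl⟩ := exists_circleDist_eq θ b c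
  have h := circleDist_le hθ a c (k + l)
  rw [hk, hl]
  refine h.trans (le_trans (le_of_eq ?_) (abs_add_le _ _))
  push_cast
  congr 1
  ring

lemma circleDist_comm {θ : ℝ} (hθ : 0 < θ) (a b : ℝ) :
    circleDist θ a b = circleDist θ b a := by
  have key : ∀ a b : ℝ, circleDist θ a b ≤ circleDist θ b a := by
    intro a b
    obtain ⟨k, hk⟩ := exists_circleDist_eq θ b a
    rw [hk, ← abs_neg]
    refine (circleDist_le hθ a b (-k)).trans (le_of_eq ?_)
    push_cast
    congr 1
    ring
  exact le_antisymm (key a b) (key b a)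

lemma circleDist_congr {θ : ℝ} (hθ : 0 < θ) {a b : ℝ} (h : circleDist θ a b = 0) (c : ℝ) :
    circleDist θ c a = circleDist θ c b := by
  have h1 := circleDist_triangle hθ c a b
  have h2 := circleDist_triangle hθ c b a
  rw [circleDist_comm hθ b a] at h2
  linarith

/-- Either the circle distance is the length `|v|` of the given arc, or it is at least the
length of the complementary arc. -/
lemma circleDist_eq_or_ge {θ : ℝ} (hθ : 0 < θ) (a b : ℝ) (k : ℤ) :
    circleDist θ a b = |a - b - θ * k| ∨ θ - |a - b - θ * k| ≤ circleDist θ a b := by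
  obtain ⟨j, hj⟩ := exists_circleDist_eq θ a b
  by_cases hjk : j = k
  · left
    rw [hj, hjk]
  · right
    have h1 : (1 : ℝ) ≤ |(j : ℝ) - k| := by
      have : (1 : ℤ) ≤ |j - k| := Int.one_le_abs (sub_ne_zero.2 hjk)
      exact_mod_cast this
    have h2 : θ ≤ |θ * ((j : ℝ) - k)| := by
      rw [abs_mul, abs_of_pos hθ]
      nlinarith
    have h3 : θ * ((j : ℝ) - k) = (a - b - θ * k) - (a - b - θ * j) := by ring
    rw [h3] at h2
    have := abs_sub (a - b - θ * k) (a - b - θ * j)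
    rw [hj]
    linarith

/-- The cosine of the angle between two directions of the cone, angles being cut off at `π`. -/
def coneCos (θ a b : ℝ) : ℝ := cos (min π (circleDist θ a b))

lemma coneCos_le_one (θ a b : ℝ) : coneCos θ a b ≤ 1 := cos_le_one _

lemma coneCos_of_pi_le {θ a b : ℝ} (h : π ≤ circleDist θ a b) : coneCos θ a b = -1 := by
  rw [coneCos, min_eq_left h, cos_pi]

lemma coneCos_of_le_pi {θ a b : ℝ} (h : circleDist θ a b ≤ π) :
    coneCos θ a b = cos (circleDist θ a b) := by
  rw [coneCos, min_eq_right h]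

lemma coneCos_le_cos_of_le {θ a b x : ℝ} (h0 : 0 ≤ x) (hx : x ≤ π)
    (h : x ≤ circleDist θ a b) : coneCos θ a b ≤ cos x :=
  cos_le_cos_of_nonneg_of_le_pi h0 (min_le_left _ _) (le_min hx h)

lemma coneCos_le_cos {θ : ℝ} (hθ : 2 * π ≤ θ) (a b : ℝ) (k : ℤ)
    (hv : |a - b - θ * k| ≤ 2 * π) : coneCos θ a b ≤ cos (a - b - θ * k) := by
  have hpi := pi_pos
  have hθ0 : 0 < θ := by linarith
  rw [← cos_abs (a - b - θ * k)]
  rcases le_total |a - b - θ * k| π with h | h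
  · refine coneCos_le_cos_of_le (abs_nonneg _) h ?_
    rcases circleDist_eq_or_ge hθ0 a b k with h' | h' <;> linarith
  · rw [← cos_two_pi_sub]
    refine coneCos_le_cos_of_le (by linarith) (by linarith) ?_
    rcases circleDist_eq_or_ge hθ0 a b k with h' | h' <;> linarith

lemma coneDist_eq_sqrt (θ : ℝ) {p q : ℝ × ℝ} (hp : 0 ≤ p.1) (hq : 0 ≤ q.1) :
    coneDist θ p q = √(p.1 ^ 2 + q.1 ^ 2 - 2 * p.1 * q.1 * coneCos θ p.2 q.2) := by
  unfold coneDist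
  split_ifs with h
  · rw [coneCos_of_pi_le h, ← sqrt_sq (add_nonneg hp hq)]
    congr 1
    ring
  · rw [coneCos_of_le_pi (not_le.1 h).le]

lemma coneDist_sq (θ : ℝ) {p q : ℝ × ℝ} (hp : 0 ≤ p.1) (hq : 0 ≤ q.1) :
    coneDist θ p q ^ 2 = p.1 ^ 2 + q.1 ^ 2 - 2 * p.1 * q.1 * coneCos θ p.2 q.2 := by
  rw [coneDist_eq_sqrt θ hp hq, sq_sqrt]
  have := mul_nonneg (mul_nonneg hp hq) (sub_nonneg.2 (coneCos_le_one θ p.2 q.2))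
  nlinarith [sq_nonneg (p.1 - q.1)]

lemma circleDist_eq_zero_of_coneCos_eq_one {θ a b : ℝ} (h : coneCos θ a b = 1) :
    circleDist θ a b = 0 := by
  have h0 := circleDist_nonneg θ a b
  have h1 : 0 ≤ min π (circleDist θ a b) := le_min pi_pos.le h0
  have h2 : min π (circleDist θ a b) = 0 := by
    by_contra hne
    have hpos : 0 < min π (circleDist θ a b) := lt_of_le_of_ne h1 (Ne.symm hne)
    have := cos_lt_cos_of_nonneg_of_le_pi le_rfl (min_le_left π (circleDist θ a b)) hpos
    rw [cos_zero] at this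
    exact absurd h (ne_of_lt this)
  rcases min_choice π (circleDist θ a b) with h3 | h3
  · exact absurd (h3 ▸ h2) pi_pos.ne'
  · rw [← h3, h2]

lemma fst_eq_of_coneDist_eq_zero {θ : ℝ} {p q : ℝ × ℝ} (hp : 0 ≤ p.1) (hq : 0 ≤ q.1)
    (h : coneDist θ p q = 0) : p.1 = q.1 ∧ (q.1 = 0 ∨ circleDist θ p.2 q.2 = 0) := by
  have h1 := coneDist_sq θ hp hq
  have h2 := mul_nonneg (mul_nonneg hp hq) (sub_nonneg.2 (coneCos_le_one θ p.2 q.2))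
  rw [h] at h1
  have h3 : p.1 - q.1 = 0 := by
    apply pow_eq_zero_iff (two_ne_zero) |>.1
    nlinarith [sq_nonneg (p.1 - q.1)]
  have h4 : p.1 = q.1 := by linarith
  refine ⟨h4, ?_⟩
  rcases hq.eq_or_lt with h5 | h5
  · exact Or.inl h5.symm
  · right
    apply circleDist_eq_zero_of_coneCos_eq_one
    rw [h4] at h1 h2
    have : q.1 * q.1 * (1 - coneCos θ p.2 q.2) = 0 := by nlinarith
    have := (mul_eq_zero.1 this).resolve_left (mul_pos h5 h5).ne'
    linarith

lemma coneDist_congr {θ : ℝ} (hθ : 0 < θ) {p q : ℝ × ℝ} (hp : 0 ≤ p.1) (hq : 0 ≤ q.1)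
    (h : coneDist θ p q = 0) {z : ℝ × ℝ} (hz : 0 ≤ z.1) :
    coneDist θ z p = coneDist θ z q := by
  obtain ⟨h1, h2⟩ := fst_eq_of_coneDist_eq_zero hp hq h
  rw [coneDist_eq_sqrt θ hz hp, coneDist_eq_sqrt θ hz hq, h1]
  rcases h2 with h2 | h2
  · simp [h2]
  · rw [coneCos, coneCos, circleDist_congr hθ h2]

/-- Polar coordinates of the midpoint of two points of a cone of angle at least `2π`: the second
property says that Busemann functions are convex. -/
lemma exists_cone_midpoint {θ : ℝ} (hθ : 2 * π ≤ θ) {r₁ r₂ : ℝ} (h₁ : 0 ≤ r₁) (h₂ : 0 ≤ r₂)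
    (t₁ t₂ : ℝ) :
    ∃ r ψ : ℝ, 0 ≤ r ∧ 4 * r ^ 2 = r₁ ^ 2 + r₂ ^ 2 + 2 * r₁ * r₂ * coneCos θ t₁ t₂ ∧
      ∀ s, r₁ * coneCos θ s t₁ + r₂ * coneCos θ s t₂ ≤ 2 * r * coneCos θ s ψ := by
  have hpi := pi_pos
  have hθ0 : 0 < θ := by linarith
  rcases le_or_gt π (circleDist θ t₁ t₂) with hc | hc
  · have hsum : ∀ s, coneCos θ s t₁ + coneCos θ s t₂ ≤ 0 := by
      intro s
      have h3 := circleDist_triangle hθ0 t₁ s t₂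
      rw [circleDist_comm hθ0 t₁ s] at h3
      rcases le_total π (circleDist θ s t₁) with h4 | h4
      · rw [coneCos_of_pi_le h4]
        linarith [coneCos_le_one θ s t₂]
      · have := coneCos_le_cos_of_le (θ := θ) (a := s) (b := t₂) (x := π - circleDist θ s t₁)
          (by linarith) (by linarith [circleDist_nonneg θ s t₁]) (by linarith)
        rw [cos_pi_sub] at this
        rw [coneCos_of_le_pi h4]
        linarith
    rw [coneCos_of_pi_le hc]
    rcases le_total r₂ r₁ with h | h
    · refine ⟨(r₁ - r₂) / 2, t₁, by linarith, by ring, fun s => ?_⟩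
      nlinarith [mul_nonneg h₂ (neg_nonneg.2 (hsum s))]
    · refine ⟨(r₂ - r₁) / 2, t₂, by linarith, by ring, fun s => ?_⟩
      nlinarith [mul_nonneg h₁ (neg_nonneg.2 (hsum s))]
  · obtain ⟨k, hk⟩ := exists_circleDist_eq θ t₂ t₁
    rw [circleDist_comm hθ0 t₂ t₁] at hk
    set u : ℝ := t₂ - t₁ - θ * k with hu
    have huc : |u| < π := hk ▸ hc
    obtain ⟨hu1, hu2⟩ := abs_lt.1 huc
    set w : ℂ := ⟨(r₁ + r₂ * cos u) / 2, r₂ * sin u / 2⟩ with hw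
    have hre : ‖w‖ * cos w.arg = (r₁ + r₂ * cos u) / 2 := Complex.norm_mul_cos_arg w
    have him : ‖w‖ * sin w.arg = r₂ * sin u / 2 := Complex.norm_mul_sin_arg w
    have harg : |w.arg| ≤ π := Complex.abs_arg_le_pi w
    have hargu : |w.arg - u| ≤ π := by
      obtain ⟨ha1, ha2⟩ := abs_le.1 harg
      rw [abs_le]
      rcases le_or_gt 0 u with h0 | h0
      · have : 0 ≤ w.arg := Complex.arg_nonneg_iff.2 (by
          show 0 ≤ r₂ * sin u / 2
          have := sin_nonneg_of_nonneg_of_le_pi h0 hu2.le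
          positivity)
        constructor <;> linarith
      · rcases h₂.eq_or_lt with h3 | h3
        · have : w.arg = 0 := by
            rw [hw, ← h3]
            exact Complex.arg_eq_zero_iff.2 ⟨by simpa using div_nonneg h₁ zero_le_two, by simp⟩
          rw [this]
          constructor <;> linarith
        · have : w.arg < 0 := Complex.arg_neg_iff.2 (by
            show r₂ * sin u / 2 < 0
            have := mul_neg_of_pos_of_neg h3 (sin_neg_of_neg_of_neg_pi_lt h0 hu1)
            linarith)
          constructor <;> linarith
    have hlin : ∀ x, 2 * ‖w‖ * cos (x - w.arg) = r₁ * cos x + r₂ * cos (x - u) := by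
      intro x
      rw [cos_sub, cos_sub]
      linear_combination 2 * cos x * hre + 2 * sin x * him
    refine ⟨‖w‖, t₁ + w.arg, norm_nonneg _, ?_, fun s => ?_⟩
    · rw [coneCos_of_le_pi hc.le, hk, cos_abs]
      have e : ‖w‖ ^ 2 = (‖w‖ * cos w.arg) ^ 2 + (‖w‖ * sin w.arg) ^ 2 := by
        linear_combination -‖w‖ ^ 2 * sin_sq_add_cos_sq w.arg
      rw [e, hre, him]
      linear_combination r₂ ^ 2 * sin_sq_add_cos_sq u
    · obtain ⟨j, hj⟩ := exists_circleDist_eq θ s (t₁ + w.arg)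
      rcases le_total (circleDist θ s (t₁ + w.arg)) π with h3 | h3
      · rw [coneCos_of_le_pi h3, hj, cos_abs]
        rw [hj] at h3
        have e := hlin (s - t₁ - θ * j)
        have e1 : s - t₁ - θ * j - w.arg = s - (t₁ + w.arg) - θ * j := by ring
        have e2 : s - t₁ - θ * j - u = s - t₂ - θ * ((j - k : ℤ) : ℝ) := by
          rw [hu]; push_cast; ring
        have b1 : |s - t₁ - θ * j| ≤ 2 * π := by
          have e3 : s - t₁ - θ * j = (s - (t₁ + w.arg) - θ * j) + w.arg := by ring
          rw [e3]
          exact (abs_add_le _ _).trans (by linarith)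
        have b2 : |s - t₂ - θ * ((j - k : ℤ) : ℝ)| ≤ 2 * π := by
          have e3 : s - t₂ - θ * ((j - k : ℤ) : ℝ)
              = (s - (t₁ + w.arg) - θ * j) + (w.arg - u) := by
            rw [hu]; push_cast; ring
          rw [e3]
          exact (abs_add_le _ _).trans (by linarith)
        have c1 := coneCos_le_cos hθ s t₁ j b1
        have c2 := coneCos_le_cos hθ s t₂ (j - k) b2
        rw [← e2] at c2
        rw [e1] at e
        rw [e]
        exact add_le_add (mul_le_mul_of_nonneg_left c1 h₁) (mul_le_mul_of_nonneg_left c2 h₂)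
      · rw [coneCos_of_pi_le h3]
        have e := hlin w.arg
        rw [sub_self, cos_zero] at e
        have d1 : circleDist θ t₁ (t₁ + w.arg) ≤ |w.arg| := by
          refine (circleDist_le hθ0 _ _ 0).trans (le_of_eq ?_)
          rw [← abs_neg]
          congr 1
          push_cast
          ring
        have d2 : circleDist θ t₂ (t₁ + w.arg) ≤ |w.arg - u| := by
          refine (circleDist_le hθ0 _ _ k).trans (le_of_eq ?_)
          rw [← abs_neg, hu]
          congr 1
          ring
        have c1 := coneCos_le_cos_of_le (θ := θ) (a := s) (b := t₁) (x := π - |w.arg|)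
          (by linarith) (by linarith [abs_nonneg w.arg])
          (by linarith [circleDist_triangle hθ0 s t₁ (t₁ + w.arg)])
        have c2 := coneCos_le_cos_of_le (θ := θ) (a := s) (b := t₂) (x := π - |w.arg - u|)
          (by linarith) (by linarith [abs_nonneg (w.arg - u)])
          (by linarith [circleDist_triangle hθ0 s t₂ (t₁ + w.arg)])
        rw [cos_pi_sub, cos_abs] at c1 c2
        nlinarith [mul_le_mul_of_nonneg_left c1 h₁, mul_le_mul_of_nonneg_left c2 h₂]

/-- Around `a`, any two points have a midpoint satisfying the Bruhat-Tits (CN) inequality. -/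
def IsLocallyCNAt {S : Type*} [MetricSpace S] (a : S) : Prop :=
  ∃ ε > 0, ∀ x ∈ ball a ε, ∀ y ∈ ball a ε, ∃ m, ∀ z ∈ ball a ε,
    dist z m ^ 2 ≤ dist z x ^ 2 / 2 + dist z y ^ 2 / 2 - dist x y ^ 2 / 4

lemma IsConicalPoint.isLocallyCNAt {S : Type*} [MetricSpace S] {θ : ℝ} (hθ : 2 * π ≤ θ) {a : S}
    (h : IsConicalPoint θ a) : IsLocallyCNAt a := by
  have hθ0 : 0 < θ := by linarith [pi_pos]
  obtain ⟨ε, hε, f, -, hr, hd, hs⟩ := h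
  refine ⟨ε, hε, fun x hx y hy => ?_⟩
  obtain ⟨r, ψ, h0, h1, h2⟩ :=
    exists_cone_midpoint hθ (hr x hx).1 (hr y hy).1 (f x).2 (f y).2
  have hrε : r < ε := by
    have := coneCos_le_one θ (f x).2 (f y).2
    have := mul_le_mul_of_nonneg_left this (mul_nonneg (hr x hx).1 (hr y hy).1)
    have h3 : 2 * r ≤ (f x).1 + (f y).1 :=
      abs_le_of_sq_le_sq' (by nlinarith) (add_nonneg (hr x hx).1 (hr y hy).1) |>.2
    linarith [(hr x hx).2, (hr y hy).2]
  obtain ⟨m, hm, hmd⟩ := hs r ψ h0 hrε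
  refine ⟨m, fun z hz => ?_⟩
  rw [← hd z hz m hm, ← hd z hz x hx, ← hd z hz y hy, ← hd x hx y hy,
    coneDist_congr hθ0 (hr m hm).1 h0 hmd (hr z hz).1, coneDist_sq θ (hr z hz).1 h0,
    coneDist_sq θ (hr z hz).1 (hr x hx).1, coneDist_sq θ (hr z hz).1 (hr y hy).1,
    coneDist_sq θ (hr x hx).1 (hr y hy).1]
  have := mul_le_mul_of_nonneg_left (h2 (f z).2) (hr z hz).1
  simp only
  nlinarith

lemma IsRegularPoint.isLocallyCNAt {S : Type*} [MetricSpace S] {a : S}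
    (h : IsRegularPoint a) : IsLocallyCNAt a := by
  obtain ⟨ε, hε, f, hd, hs⟩ := h
  refine ⟨ε, hε, fun x hx y hy => ?_⟩
  have hmem : midpoint ℝ (f x) (f y) ∈ f '' ball a ε := by
    rw [hs]
    have hx' : f x ∈ ball (f a) ε := hs ▸ mem_image_of_mem f hx
    have hy' : f y ∈ ball (f a) ε := hs ▸ mem_image_of_mem f hy
    exact (convex_ball (f a) ε).midpoint_mem hx' hy'
  obtain ⟨m, hm, hmf⟩ := hmem
  refine ⟨m, fun z hz => ?_⟩
  have := EuclideanGeometry.dist_sq_add_dist_sq_eq_two_mul_dist_midpoint_sq_add_half_dist_sq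
    (f z) (f x) (f y)
  rw [← hmf, hd z hz m hm, hd z hz x hx, hd z hz y hy, hd x hx y hy] at this
  linarith

/-- The Bruhat-Tits (CN) inequality at the uniform scale `R`. -/
def IsUniformlyCN (S : Type*) [MetricSpace S] (R : ℝ) : Prop :=
  ∀ x y : S, dist x y < R → ∃ m, ∀ z, dist z x < R →
    dist z m ^ 2 ≤ dist z x ^ 2 / 2 + dist z y ^ 2 / 2 - dist x y ^ 2 / 4

lemma exists_isUniformlyCN {S : Type*} [MetricSpace S] [CompactSpace S]
    (h : ∀ a : S, IsLocallyCNAt a) : ∃ R > 0, IsUniformlyCN S R := by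
  choose ε hε hCN using h
  obtain ⟨R, hR, hleb⟩ := lebesgue_number_lemma_of_metric (s := (univ : Set S))
    (c := fun a => ball a (ε a)) isCompact_univ (fun a => isOpen_ball)
    (fun a _ => mem_iUnion.2 ⟨a, mem_ball_self (hε a)⟩)
  refine ⟨R, hR, fun x y hxy => ?_⟩
  obtain ⟨a, ha⟩ := hleb x (mem_univ x)
  obtain ⟨m, hm⟩ := hCN a x (ha (mem_ball_self hR)) y (ha (by rwa [mem_ball, dist_comm]))
  exact ⟨m, fun z hz => hm z (ha hz)⟩

/-- `m` is a midpoint of `x` and `y`. -/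
def IsMid {S : Type*} [MetricSpace S] (x y m : S) : Prop :=
  dist x m = dist x y / 2 ∧ dist m y = dist x y / 2

namespace IsUniformlyCN

variable {S : Type*} [MetricSpace S] {R : ℝ}

lemma exists_isMid (h : IsUniformlyCN S R) {x y : S} (hxy : dist x y < R) :
    ∃ m, IsMid x y m := by
  obtain ⟨m, hm⟩ := h x y hxy
  have hR : 0 < R := dist_nonneg.trans_lt hxy
  have h1 := hm x (by simpa using hR)
  have h2 := hm y (by rwa [dist_comm])
  rw [dist_self] at h1 h2
  rw [dist_comm y x] at h2
  have h3 : dist x m ≤ dist x y / 2 := abs_le_of_sq_le_sq' (by nlinarith) (by positivity) |>.2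
  have h4 : dist y m ≤ dist x y / 2 := abs_le_of_sq_le_sq' (by nlinarith) (by positivity) |>.2
  rw [dist_comm] at h4
  have := dist_triangle x m y
  exact ⟨m, by linarith, by linarith⟩

lemma cn_of_isMid (h : IsUniformlyCN S R) {x y m : S} (hxy : dist x y < R) (hm : IsMid x y m)
    {z : S} (hz : dist z x < R) :
    dist z m ^ 2 ≤ dist z x ^ 2 / 2 + dist z y ^ 2 / 2 - dist x y ^ 2 / 4 := by
  obtain ⟨m', hm'⟩ := h x y hxy
  have h0 : 0 ≤ dist x y := dist_nonneg
  have h1 := hm' m (by rw [dist_comm, hm.1]; linarith)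
  rw [dist_comm m x, hm.1, hm.2] at h1
  have h2 : dist m m' = 0 := by
    apply pow_eq_zero_iff two_ne_zero |>.1
    nlinarith [sq_nonneg (dist m m')]
  rw [eq_of_dist_eq_zero h2]
  exact hm' z hz

lemma isMid_unique (h : IsUniformlyCN S R) {x y m m' : S} (hxy : dist x y < R)
    (hm : IsMid x y m) (hm' : IsMid x y m') : m = m' := by
  have h0 : 0 ≤ dist x y := dist_nonneg
  have h1 := h.cn_of_isMid hxy hm' (z := m) (by rw [dist_comm, hm.1]; linarith)
  rw [dist_comm m x, hm.1, hm.2] at h1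
  apply eq_of_dist_eq_zero
  apply pow_eq_zero_iff two_ne_zero |>.1
  nlinarith [sq_nonneg (dist m m')]

lemma dist_mid_le_of_common_apex (h : IsUniformlyCN S R) {x y y' m m' : S}
    (hxy : dist x y < R) (hxy' : dist x y' < R) (hm : IsMid x y m) (hm' : IsMid x y' m') :
    dist m m' ≤ dist y y' / 2 := by
  have h0 : 0 ≤ dist x y := dist_nonneg
  have h1 := h.cn_of_isMid hxy' hm' (z := m) (by rw [dist_comm, hm.1]; linarith)
  have h2 := h.cn_of_isMid hxy hm (z := y') (by rwa [dist_comm])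
  rw [dist_comm m x, hm.1] at h1
  rw [dist_comm y' m, dist_comm y' x, dist_comm y' y] at h2
  exact abs_le_of_sq_le_sq' (by nlinarith) (by positivity) |>.2

/-- Busemann convexity. -/
lemma dist_mid_le (h : IsUniformlyCN S R) {x y x' y' m m' : S} (hxy : dist x y < R)
    (hxy' : dist x' y' < R) (hd : dist x y' < R) (hm : IsMid x y m) (hm' : IsMid x' y' m') :
    dist m m' ≤ (dist x x' + dist y y') / 2 := by
  obtain ⟨n, hn⟩ := h.exists_isMid hd
  have h1 := h.dist_mid_le_of_common_apex hxy hd hm hn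
  have symm : ∀ {a b c : S}, IsMid a b c → IsMid b a c := fun {a b c} k =>
    ⟨by rw [dist_comm, k.2, dist_comm a b], by rw [dist_comm, k.1, dist_comm a b]⟩
  have h2 := h.dist_mid_le_of_common_apex (x := y') (by rwa [dist_comm]) (by rwa [dist_comm])
    (symm hn) (symm hm')
  linarith [dist_triangle m n m']

end IsUniformlyCN

open Classical in
/-- A chosen midpoint of `x` and `y`, when there is one. -/
def someMid {S : Type*} [MetricSpace S] (x y : S) : S :=
  if h : ∃ m, IsMid x y m then h.choose else x

/-- One step of the Birkhoff curve shortening process on polygons with vertices `w 0, …, w N`: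
inner vertices are replaced by the midpoints of their neighbours. -/
def shorten {S : Type*} [MetricSpace S] (N : ℕ) (w : ℕ → S) : ℕ → S := fun i =>
  if 0 < i ∧ i < N then someMid (w (i - 1)) (w (i + 1)) else w i

section Shorten

variable {S : Type*} [MetricSpace S] {R δ : ℝ} {N : ℕ}

lemma shorten_of_not {i : ℕ} (hi : ¬(0 < i ∧ i < N)) (w : ℕ → S) : shorten N w i = w i :=
  if_neg hi

lemma dist_shorten_ends_le {w : ℕ → S} (hw : ∀ i < N, dist (w i) (w (i + 1)) ≤ δ) {i : ℕ}
    (hi : i + 1 < N) : dist (w i) (w (i + 2)) ≤ 2 * δ := by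
  linarith [dist_triangle (w i) (w (i + 1)) (w (i + 2)), hw i (by omega), hw (i + 1) hi]

lemma isMid_shorten (h : IsUniformlyCN S R) (hδ : 4 * δ < R) (hδ0 : 0 < δ) {w : ℕ → S}
    (hw : ∀ i < N, dist (w i) (w (i + 1)) ≤ δ) {i : ℕ} (hi : i + 1 < N) :
    IsMid (w i) (w (i + 2)) (shorten N w (i + 1)) := by
  have h1 : ∃ m, IsMid (w i) (w (i + 2)) m :=
    h.exists_isMid (by linarith [dist_shorten_ends_le hw hi])
  have h2 : shorten N w (i + 1) = someMid (w i) (w (i + 2)) := if_pos ⟨i.succ_pos, hi⟩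
  rw [h2, someMid, dif_pos h1]
  exact h1.choose_spec

lemma shorten_steps (h : IsUniformlyCN S R) (hδ : 4 * δ < R) (hδ0 : 0 < δ) {w : ℕ → S}
    (hw : ∀ i < N, dist (w i) (w (i + 1)) ≤ δ) :
    ∀ i < N, dist (shorten N w i) (shorten N w (i + 1)) ≤ δ := by
  intro i hi
  rcases i with _ | i
  · rw [shorten_of_not (by omega) w]
    rcases Nat.lt_or_ge 1 N with h1 | h1
    · have := isMid_shorten h hδ hδ0 hw (i := 0) h1
      rw [this.1]
      linarith [dist_shorten_ends_le hw (i := 0) h1]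
    · rw [shorten_of_not (by omega) w]
      exact hw 0 hi
  · have m1 := isMid_shorten h hδ hδ0 hw hi
    rcases Nat.lt_or_ge (i + 2) N with h1 | h1
    · have m2 := isMid_shorten h hδ hδ0 hw (i := i + 1) h1
      have a1 := dist_shorten_ends_le hw hi
      have a2 := dist_shorten_ends_le hw (i := i + 1) h1
      have b1 := hw i (by omega)
      have b2 := hw (i + 2) h1
      have := h.dist_mid_le (by linarith) (by linarith)
        (by linarith [dist_triangle (w i) (w (i + 2)) (w (i + 3))]) m1 m2
      linarith
    · rw [shorten_of_not (i := i + 1 + 1) (by omega) w, m1.2]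
      linarith [dist_shorten_ends_le hw hi]

lemma dist_shorten_le (h : IsUniformlyCN S R) (hδ : 4 * δ < R) (hδ0 : 0 < δ) {w w' : ℕ → S}
    (hw : ∀ i < N, dist (w i) (w (i + 1)) ≤ δ) (hw' : ∀ i < N, dist (w' i) (w' (i + 1)) ≤ δ)
    (hc : ∀ i ≤ N, dist (w i) (w' i) ≤ δ) {i : ℕ} (hi : i + 1 < N) :
    dist (shorten N w (i + 1)) (shorten N w' (i + 1)) ≤
      (dist (w i) (w' i) + dist (w (i + 2)) (w' (i + 2))) / 2 := by
  have a1 := dist_shorten_ends_le hw hi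
  have a2 := dist_shorten_ends_le hw' hi
  have b := hc (i + 2) hi
  exact h.dist_mid_le (by linarith) (by linarith)
    (by linarith [dist_triangle (w i) (w (i + 2)) (w' (i + 2))])
    (isMid_shorten h hδ hδ0 hw hi) (isMid_shorten h hδ hδ0 hw' hi)

lemma iterate_shorten_steps (h : IsUniformlyCN S R) (hδ : 4 * δ < R) (hδ0 : 0 < δ) {w : ℕ → S}
    (hw : ∀ i < N, dist (w i) (w (i + 1)) ≤ δ) (k : ℕ) :
    ∀ i < N, dist ((shorten N)^[k] w i) ((shorten N)^[k] w (i + 1)) ≤ δ := by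
  induction k with
  | zero => exact hw
  | succ k ih =>
    rw [Function.iterate_succ_apply']
    exact shorten_steps h hδ hδ0 ih

lemma dist_iterate_shorten_le (h : IsUniformlyCN S R) (hδ : 4 * δ < R) (hδ0 : 0 < δ)
    {w w' : ℕ → S} (hw : ∀ i < N, dist (w i) (w (i + 1)) ≤ δ)
    (hw' : ∀ i < N, dist (w' i) (w' (i + 1)) ≤ δ) {κ : ℝ} (hκ : κ ≤ δ)
    (hc : ∀ i ≤ N, dist (w i) (w' i) ≤ κ) (k : ℕ) :
    ∀ i ≤ N, dist ((shorten N)^[k] w i) ((shorten N)^[k] w' i) ≤ κ := by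
  induction k with
  | zero => exact hc
  | succ k ih =>
    intro i hi
    rw [Function.iterate_succ_apply', Function.iterate_succ_apply']
    rcases i with _ | i
    · rw [shorten_of_not (by omega), shorten_of_not (by omega)]
      exact ih 0 hi
    · rcases hi.lt_or_eq with h1 | h1
      · have := dist_shorten_le h hδ hδ0 (iterate_shorten_steps h hδ hδ0 hw k)
          (iterate_shorten_steps h hδ hδ0 hw' k) (fun j hj => (ih j hj).trans hκ) h1
        linarith [ih i (by omega), ih (i + 2) h1]
      · rw [shorten_of_not (by omega), shorten_of_not (by omega)]
        exact ih _ hi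

/-- Two nearby polygons with the same ends are contracted towards each other. -/
lemma dist_iterate_shorten_le_geometric (h : IsUniformlyCN S R) (hδ : 4 * δ < R) (hδ0 : 0 < δ)
    (hN : 0 < N) {w w' : ℕ → S} (hw : ∀ i < N, dist (w i) (w (i + 1)) ≤ δ)
    (hw' : ∀ i < N, dist (w' i) (w' (i + 1)) ≤ δ)
    (hc : ∀ i ≤ N, dist (w i) (w' i) ≤ δ) (h0 : w 0 = w' 0) (h1 : w N = w' N) (k : ℕ) :
    ∀ i ≤ N, dist ((shorten N)^[k] w i) ((shorten N)^[k] w' i) ≤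
      δ * (1 - 1 / (N : ℝ) ^ 2) ^ k * (i * (N - i)) := by
  have hNR : (1 : ℝ) ≤ N := by exact_mod_cast hN
  induction k with
  | zero =>
    intro i hi
    simp only [Function.iterate_zero, id, pow_zero, mul_one]
    rcases Nat.eq_zero_or_pos i with h2 | h2
    · subst h2; simp [h0]
    · rcases hi.eq_or_lt with h3 | h3
      · subst h3; simp [h1]
      · have e1 : (1 : ℝ) ≤ i := by exact_mod_cast h2
        have e2 : (i : ℝ) + 1 ≤ N := by exact_mod_cast h3
        have : (1 : ℝ) ≤ i * (N - i) := by nlinarith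
        nlinarith [hc i hi]
  | succ k ih =>
    intro i hi
    rw [Function.iterate_succ_apply', Function.iterate_succ_apply']
    have hlam : 0 ≤ 1 - 1 / (N : ℝ) ^ 2 := by
      rw [sub_nonneg, div_le_one (by positivity)]
      nlinarith
    rcases i with _ | i
    · rw [shorten_of_not (by omega), shorten_of_not (by omega)]
      simpa using ih 0 hi
    · rcases hi.lt_or_eq with h2 | h2
      · have h3 := dist_shorten_le h hδ hδ0 (iterate_shorten_steps h hδ hδ0 hw k)
          (iterate_shorten_steps h hδ hδ0 hw' k)
          (dist_iterate_shorten_le h hδ hδ0 hw hw' le_rfl hc k) h2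
        have h4 := ih i (by omega)
        have h5 := ih (i + 2) h2
        set c := δ * (1 - 1 / (N : ℝ) ^ 2) ^ k with hcdef
        have hc0 : 0 ≤ c := mul_nonneg hδ0.le (pow_nonneg hlam k)
        have h6 : ((i : ℝ) + 1) * (N - (i + 1)) ≤ (N : ℝ) ^ 2 := by
          have : (i : ℝ) + 1 ≤ N := by exact_mod_cast hi
          nlinarith [sq_nonneg ((i : ℝ) + 1)]
        have h7 : 1 / (N : ℝ) ^ 2 * (((i : ℝ) + 1) * (N - (i + 1))) ≤ 1 := by
          rw [one_div_mul_eq_div, div_le_one (by positivity)]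
          exact h6
        have h8 := mul_le_mul_of_nonneg_left h7 hc0
        rw [pow_succ]
        push_cast at h5 ⊢
        calc _ ≤ _ := h3
          _ ≤ c * ((i + 1) * (N - (i + 1))) - c := by nlinarith
          _ ≤ c * ((i + 1) * (N - (i + 1)))
              - c * (1 / (N : ℝ) ^ 2 * (((i : ℝ) + 1) * (N - (i + 1)))) := by linarith
          _ = _ := by rw [hcdef]; ring
      · rw [shorten_of_not (by omega), shorten_of_not (by omega)]
        have := ih (i + 1) hi
        rw [h2] at this ⊢
        simpa using this

lemma tendsto_dist_iterate_shorten (h : IsUniformlyCN S R) (hδ : 4 * δ < R) (hδ0 : 0 < δ)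
    (hN : 0 < N) {w w' : ℕ → S} (hw : ∀ i < N, dist (w i) (w (i + 1)) ≤ δ)
    (hw' : ∀ i < N, dist (w' i) (w' (i + 1)) ≤ δ)
    (hc : ∀ i ≤ N, dist (w i) (w' i) ≤ δ) (h0 : w 0 = w' 0) (h1 : w N = w' N) {i : ℕ}
    (hi : i ≤ N) :
    Filter.Tendsto (fun k => dist ((shorten N)^[k] w i) ((shorten N)^[k] w' i))
      Filter.atTop (nhds 0) := by
  have hNR : (1 : ℝ) ≤ N := by exact_mod_cast hN
  have hlam : 0 ≤ 1 - 1 / (N : ℝ) ^ 2 := by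
    rw [sub_nonneg, div_le_one (by positivity)]
    nlinarith
  have hlt : 1 - 1 / (N : ℝ) ^ 2 < 1 := by
    have : 0 < 1 / (N : ℝ) ^ 2 := by positivity
    linarith
  refine squeeze_zero (fun _ => dist_nonneg)
    (fun k => dist_iterate_shorten_le_geometric h hδ hδ0 hN hw hw' hc h0 h1 k i hi) ?_
  simpa using ((tendsto_pow_atTop_nhds_zero_of_lt_one hlam hlt).const_mul δ).mul_const
    ((i : ℝ) * (N - i))

lemma iterate_shorten_of_isMid (h : IsUniformlyCN S R) (hδ : 4 * δ < R) (hδ0 : 0 < δ)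
    {w : ℕ → S} (hw : ∀ i < N, dist (w i) (w (i + 1)) ≤ δ)
    (hm : ∀ i, i + 1 < N → IsMid (w i) (w (i + 2)) (w (i + 1))) (k : ℕ) :
    (shorten N)^[k] w = w := by
  apply Function.iterate_fixed
  funext i
  by_cases hi : 0 < i ∧ i < N
  · obtain ⟨j, rfl⟩ : ∃ j, i = j + 1 := ⟨i - 1, by omega⟩
    exact h.isMid_unique (by linarith [dist_shorten_ends_le hw hi.2])
      (isMid_shorten h hδ hδ0 hw hi.2) (hm j hi.2)
  · exact shorten_of_not hi w

/-- Rigidity of geodesic polygons under discrete homotopies. -/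
lemma dist_le_of_discrete_homotopy (h : IsUniformlyCN S R) (hδ : 4 * δ < R) (hδ0 : 0 < δ)
    (hN : 0 < N) {J : ℕ} {W : ℕ → ℕ → S} {b : ℕ → S} {κ : ℝ} (hκ : κ ≤ δ)
    (hW : ∀ j ≤ J, ∀ i < N, dist (W j i) (W j (i + 1)) ≤ δ)
    (hb : ∀ i < N, dist (b i) (b (i + 1)) ≤ δ)
    (hWW : ∀ j < J, ∀ i ≤ N, dist (W j i) (W (j + 1) i) ≤ δ)
    (hW0 : ∀ j < J, W j 0 = W (j + 1) 0) (hWN : ∀ j < J, W j N = W (j + 1) N)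
    (hm : ∀ i, i + 1 < N → IsMid (W 0 i) (W 0 (i + 2)) (W 0 (i + 1)))
    (hmb : ∀ i, i + 1 < N → IsMid (b i) (b (i + 2)) (b (i + 1)))
    (hWb : ∀ i ≤ N, dist (W J i) (b i) ≤ κ) {i : ℕ} (hi : i ≤ N) :
    dist (W 0 i) (b i) ≤ κ := by
  have key : ∀ j ≤ J, Filter.Tendsto
      (fun k => dist ((shorten N)^[k] (W 0) i) ((shorten N)^[k] (W j) i))
      Filter.atTop (nhds 0) := by
    intro j
    induction j with
    | zero => intro _; simp
    | succ j ih =>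
      intro hj
      have t1 := ih (by omega)
      have t2 := tendsto_dist_iterate_shorten h hδ hδ0 hN (hW j (by omega)) (hW (j + 1) hj)
        (hWW j hj) (hW0 j hj) (hWN j hj) hi
      refine squeeze_zero (fun _ => dist_nonneg) (fun k =>
        dist_triangle _ ((shorten N)^[k] (W j) i) _) (by simpa using t1.add t2)
  have hlim := (key J le_rfl).add_const κ
  rw [zero_add] at hlim
  refine ge_of_tendsto' hlim fun k => ?_
  have e1 := iterate_shorten_of_isMid h hδ hδ0 (hW 0 J.zero_le) hm k
  have e2 := iterate_shorten_of_isMid h hδ hδ0 hb hmb k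
  have e3 := dist_iterate_shorten_le h hδ hδ0 (hW J le_rfl) hb hκ hWb k i hi
  rw [e2] at e3
  rw [e1]
  linarith [dist_triangle (W 0 i) ((shorten N)^[k] (W J) i) (b i)]

end Shorten

/-- Rigidity of constant speed local geodesics on `[0, 1]` under homotopies fixing the ends. -/
lemma dist_le_of_homotopy {S : Type*} [MetricSpace S] {R δ κ : ℝ} (h : IsUniformlyCN S R)
    (hδ : 4 * δ < R) (hδ0 : 0 < δ) (hκ : κ ≤ δ) {F : ℝ × ℝ → S} (hF : UniformContinuous F)
    (hF0 : ∀ σ, F (σ, 0) = F (0, 0)) (hF1 : ∀ σ, F (σ, 1) = F (0, 1)) {b : ℝ → S}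
    {v v' η : ℝ} (hη : 0 < η)
    (hv : ∀ x ∈ Icc (0 : ℝ) 1, ∀ y ∈ Icc (0 : ℝ) 1, |x - y| < η →
      dist (F (0, x)) (F (0, y)) = v * |x - y|)
    (hv' : ∀ x ∈ Icc (0 : ℝ) 1, ∀ y ∈ Icc (0 : ℝ) 1, |x - y| < η →
      dist (b x) (b y) = v' * |x - y|)
    (hb : ∀ t ∈ Icc (0 : ℝ) 1, dist (F (1, t)) (b t) ≤ κ) {t : ℝ} (ht : t ∈ Icc (0 : ℝ) 1) :
    dist (F (0, t)) (b t) ≤ κ := by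
  obtain ⟨ω, hω, hFω⟩ := Metric.uniformContinuous_iff.1 hF δ hδ0
  have small : ∀ c e : ℝ, 0 < e → ∀ᶠ n : ℕ in Filter.atTop, c / n < e := fun c e he =>
    (tendsto_const_div_atTop_nhds_zero_nat c).eventually_lt_const he
  have key : ∀ᶠ N : ℕ in Filter.atTop, dist (F (0, t)) (b t) ≤ v / N + κ + v' / N := by
    filter_upwards [small 2 η hη, small v δ hδ0, small v' δ hδ0, small 1 ω hω,
      Filter.eventually_gt_atTop 0] with N n1 n2 n3 n4 hN
    have hNR : (0 : ℝ) < N := by exact_mod_cast hN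
    have n5 : 1 / (N : ℝ) < η := lt_trans (by gcongr; norm_num) n1
    have mem : ∀ i ≤ N, (i : ℝ) / N ∈ Icc (0 : ℝ) 1 := fun i hi =>
      ⟨by positivity, (div_le_one hNR).2 (by exact_mod_cast hi)⟩
    have d1 : ∀ i : ℕ, |(i : ℝ) / N - ((i + 1 : ℕ) : ℝ) / N| = 1 / N := by
      intro i
      rw [← abs_neg, abs_of_pos (by push_cast; field_simp; linarith)]
      push_cast; field_simp; ring
    have d2 : ∀ i : ℕ, |(i : ℝ) / N - ((i + 2 : ℕ) : ℝ) / N| = 2 / N := by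
      intro i
      rw [← abs_neg, abs_of_pos (by push_cast; field_simp; linarith)]
      push_cast; field_simp; ring
    have poly : ∀ {c : ℝ → S} {w : ℝ}, (∀ x ∈ Icc (0 : ℝ) 1, ∀ y ∈ Icc (0 : ℝ) 1, |x - y| < η →
        dist (c x) (c y) = w * |x - y|) → ∀ i, i + 1 < N →
        IsMid (c ((i : ℕ) / N)) (c ((i + 2 : ℕ) / N)) (c ((i + 1 : ℕ) / N)) := by
      intro c w hc i hi
      constructor
      · rw [hc _ (mem i (by omega)) _ (mem (i + 1) (by omega)) (by rwa [d1]),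
          hc _ (mem i (by omega)) _ (mem (i + 2) (by omega)) (by rwa [d2]), d1, d2]
        ring
      · rw [hc _ (mem (i + 1) (by omega)) _ (mem (i + 2) (by omega)) (by rwa [d1 (i + 1)]),
          hc _ (mem i (by omega)) _ (mem (i + 2) (by omega)) (by rwa [d2]), d1 (i + 1), d2]
        ring
    have grid : ∀ i ≤ N, dist (F (0, i / N)) (b (i / N)) ≤ κ := by
      intro i hi
      have := dist_le_of_discrete_homotopy h hδ hδ0 hN (J := N)
        (W := fun j i => F ((j : ℝ) / N, (i : ℝ) / N)) (b := fun i => b ((i : ℝ) / N)) hκ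
        (fun j _ i _ => (hFω (by
          rw [Prod.dist_eq, dist_self, Real.dist_eq, d1]
          exact max_lt hω n4)).le)
        (fun i hi => by
          show dist (b (i / N)) (b ((i + 1 : ℕ) / N)) ≤ δ
          rw [hv' _ (mem i hi.le) _ (mem (i + 1) hi) (by rwa [d1]), d1, mul_one_div]
          exact n3.le)
        (fun j _ i _ => (hFω (by
          rw [Prod.dist_eq, dist_self, Real.dist_eq, d1]
          exact max_lt n4 hω)).le)
        (fun j _ => by simp [hF0])
        (fun j _ => by simp only [div_self hNR.ne', hF1])
        (fun i hi => by
          simpa using poly (c := fun x => F (0, x)) hv i hi)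
        (poly hv')
        (fun i hi => by
          simp only [div_self hNR.ne']
          exact hb _ (mem i hi)) hi
      simpa using this
    have f1 : (⌊t * N⌋₊ : ℝ) ≤ t * N := Nat.floor_le (mul_nonneg ht.1 hNR.le)
    have f2 : t * N < ⌊t * N⌋₊ + 1 := Nat.lt_floor_add_one _
    have f3 : ⌊t * N⌋₊ ≤ N := by
      have : (⌊t * N⌋₊ : ℝ) ≤ N := f1.trans (by nlinarith [ht.2])
      exact_mod_cast this
    have f4 : |t - (⌊t * N⌋₊ : ℝ) / N| ≤ 1 / N := by
      rw [abs_of_nonneg (by rw [sub_nonneg, div_le_iff₀ hNR]; exact f1), sub_le_iff_le_add,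
        ← add_div, le_div_iff₀ hNR]
      linarith
    have e1 := hv t ht _ (mem _ f3) (f4.trans_lt n5)
    have e2 := hv' t ht _ (mem _ f3) (f4.trans_lt n5)
    have speed : ∀ {w : ℝ} {P Q : S}, dist P Q = w * |t - (⌊t * N⌋₊ : ℝ) / N| →
        0 ≤ w → dist P Q ≤ w / N := by
      intro w P Q he hw
      rw [he, div_eq_mul_one_div w]
      exact mul_le_mul_of_nonneg_left f4 hw
    have nonneg : ∀ {c : ℝ → S} {w : ℝ}, (∀ x ∈ Icc (0 : ℝ) 1, ∀ y ∈ Icc (0 : ℝ) 1,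
        |x - y| < η → dist (c x) (c y) = w * |x - y|) → 0 ≤ w := by
      intro c w hc
      have := hc _ (mem 0 (by omega)) _ (mem (0 + 1) hN) (by rwa [d1])
      rw [d1] at this
      have h0 : 0 ≤ w * (1 / N) := this ▸ dist_nonneg
      exact nonneg_of_mul_nonneg_left h0 (by positivity)
    have g1 := speed e1 (nonneg (c := fun x => F (0, x)) hv)
    have g2 := speed e2 (nonneg hv')
    have g3 := grid _ f3
    rw [dist_comm (b t)] at g2
    linarith [dist_triangle4 (F (0, t)) (F (0, ⌊t * N⌋₊ / N)) (b (⌊t * N⌋₊ / N)) (b t)]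
  have lim := ((tendsto_const_div_atTop_nhds_zero_nat v).add_const κ).add
    (tendsto_const_div_atTop_nhds_zero_nat v')
  simp only [zero_add, add_zero] at lim
  exact ge_of_tendsto lim key

section LocalIsometry

variable {X S : Type*} [MetricSpace X] [MetricSpace S] {p : X → S}

lemma IsLocalIsometry.exists_uniform (hp : IsLocalIsometry p) {K : Set X} (hK : IsCompact K) :
    ∃ δ > 0, ∀ a ∈ K, ∀ y ∈ ball a δ, ∀ z ∈ ball a δ, dist (p y) (p z) = dist y z := by
  choose ε hε hiso using hp
  obtain ⟨δ, hδ, hleb⟩ := lebesgue_number_lemma_of_metric (c := fun a => ball a (ε a)) hK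
    (fun a => isOpen_ball) (fun a _ => mem_iUnion.2 ⟨a, mem_ball_self (hε a)⟩)
  refine ⟨δ, hδ, fun a ha y hy z hz => ?_⟩
  obtain ⟨c, hc⟩ := hleb a ha
  exact hiso c y (hc hy) z (hc hz)

lemma IsLocalIsometry.exists_lift_ball (hp : IsLocalIsometry p) (ho : IsOpenMap p) (a : X) :
    ∃ κ > 0, (∀ y ∈ ball a κ, ∀ z ∈ ball a κ, dist (p y) (p z) = dist y z) ∧
      ∀ q, dist q (p a) < κ → ∃ x, p x = q ∧ dist x a = dist q (p a) := by
  obtain ⟨ε, hε, hiso⟩ := hp a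
  obtain ⟨κ, hκ, hsub⟩ := Metric.isOpen_iff.1 (ho _ isOpen_ball) (p a)
    (mem_image_of_mem p (mem_ball_self hε))
  refine ⟨min κ ε, lt_min hκ hε, fun y hy z hz =>
    hiso y (ball_subset_ball (min_le_right _ _) hy) z (ball_subset_ball (min_le_right _ _) hz),
    fun q hq => ?_⟩
  obtain ⟨x, hx, rfl⟩ := hsub (mem_ball.2 (hq.trans_le (min_le_left _ _)))
  exact ⟨x, rfl, (hiso x hx a (mem_ball_self hε)).symm⟩

lemma IsLengthSpace.exists_path (hS : IsLengthSpace S) {a b : S} {ε : ℝ} (h : dist a b < ε) :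
    ∃ γ : Path a b, ∀ t, dist (γ t) a < ε := by
  have h1 : edist a b < ENNReal.ofReal ε := by
    rw [edist_dist]
    exact (ENNReal.ofReal_lt_ofReal_iff (dist_nonneg.trans_lt h)).2 h
  rw [hS a b, iInf_lt_iff] at h1
  obtain ⟨γ, hγ⟩ := h1
  refine ⟨γ, fun t => ?_⟩
  have h2 := (eVariationOn.edist_le (fun t => γ t) (mem_univ t) (mem_univ 0)).trans_lt hγ
  simp only [Path.source, edist_dist] at h2
  exact (ENNReal.ofReal_lt_ofReal_iff (dist_nonneg.trans_lt h)).1 h2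

lemma IsLocalIsometry.exists_path (hp : IsLocalIsometry p) (ho : IsOpenMap p)
    (hS : IsLengthSpace S) (a : X) : ∃ κ > 0, ∀ ε ≤ κ, ∀ x, dist x a < ε →
      ∃ γ : Path a x, ∀ t, dist (γ t) a < ε := by
  obtain ⟨κ, hκ, hiso, hlift⟩ := hp.exists_lift_ball ho a
  refine ⟨κ, hκ, fun ε hε x hx => ?_⟩
  have ha : a ∈ ball a κ := mem_ball_self hκ
  have hxκ : x ∈ ball a κ := mem_ball.2 (hx.trans_le hε)
  obtain ⟨γ, hγ⟩ := hS.exists_path (a := p a) (b := p x) (ε := ε)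
    (by rwa [hiso a ha x hxκ, dist_comm])
  choose c hc hcd using fun t => hlift (γ t) ((hγ t).trans_le hε)
  have hcε : ∀ t, dist (c t) a < ε := fun t => (hcd t).symm ▸ hγ t
  have hmem : ∀ t, c t ∈ ball a κ := fun t => mem_ball.2 ((hcε t).trans_le hε)
  have hci : ∀ t u, dist (c t) (c u) = dist (γ t) (γ u) := fun t u => by
    rw [← hiso _ (hmem t) _ (hmem u), hc, hc]
  refine ⟨⟨⟨c, ?_⟩, ?_, ?_⟩, hcε⟩
  · rw [Metric.continuous_iff]
    intro t e he
    obtain ⟨d, hd, H⟩ := Metric.continuous_iff.1 γ.continuous t e he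
    exact ⟨d, hd, fun u hu => by rw [hci]; exact H u hu⟩
  · apply eq_of_dist_eq_zero
    rw [← hiso _ (hmem 0) _ ha, hc]
    simp
  · apply eq_of_dist_eq_zero
    rw [← hiso _ (hmem 1) _ hxκ, hc]
    simp

end LocalIsometry

lemma continuousOn_of_dist_eq {X : Type*} [MetricSpace X] {h : ℝ → X} {A : Set ℝ}
    (hh : ∀ u ∈ A, ∀ v ∈ A, dist (h u) (h v) = |u - v|) : ContinuousOn h A := by
  rw [Metric.continuousOn_iff]
  intro u hu e he
  exact ⟨e, he, fun v hv hd => by rwa [hh v hv u hu]⟩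

/-- Prolong a geodesic segment by two short paths, without changing the parametrization much. -/
lemma exists_path_near_geodesic {X : Type*} [MetricSpace X] {x₀ y₀ x y : X} {ε M ν : ℝ}
    {h : ℝ → X} (hM : 0 ≤ M)
    (hh : ∀ u ∈ Icc 0 M, ∀ v ∈ Icc 0 M, dist (h u) (h v) = |u - v|) (h0 : h 0 = x)
    (h1 : h M = y) (c : Path x₀ x) (hc : ∀ t, dist (c t) x₀ < ε) (d : Path y₀ y)
    (hd : ∀ t, dist (d t) y₀ < ε) (hν : 0 < ν) (hν4 : ν ≤ 1 / 4) :
    ∃ k : Path x₀ y₀, ∀ t : unitInterval,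
      (dist (k t) x₀ < ε ∧ (t : ℝ) ≤ ν) ∨
      (∃ u ∈ Icc 0 M, k t = h u ∧ |u - M * t| ≤ 2 * M * ν) ∨
      (dist (k t) y₀ < ε ∧ 1 - ν ≤ (t : ℝ)) := by
  have hw : 0 < 1 - 2 * ν := by linarith
  set H : ℝ → X := IccExtend hM ((Icc 0 M).domRestrict h) with hH
  have hHc : Continuous H := (continuousOn_of_dist_eq hh).domRestrict.Icc_extend'
  have hHe : ∀ u ∈ Icc 0 M, H u = h u := fun u hu => by rw [hH, IccExtend_of_mem _ _ hu]; rfl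
  have e0 : H 0 = x := by rw [hHe 0 ⟨le_rfl, hM⟩, h0]
  have e1 : H M = y := by rw [hHe M ⟨hM, le_rfl⟩, h1]
  set K : ℝ → X := fun t => if t ≤ ν then c.extend (t / ν) else
    if t ≤ 1 - ν then H ((t - ν) * M / (1 - 2 * ν)) else d.extend ((1 - t) / ν) with hK
  have hKc : Continuous K := by
    refine Continuous.if_le (by fun_prop) (Continuous.if_le (by fun_prop) (by fun_prop)
      continuous_id continuous_const ?_) continuous_id continuous_const ?_
    · rintro t rfl
      have a1 : (1 - ν - ν) * M / (1 - 2 * ν) = M := by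
        rw [div_eq_iff hw.ne']
        ring
      have a2 : (1 - (1 - ν)) / ν = 1 := by field_simp; ring
      rw [a1, a2, e1, Path.extend_one]
    · rintro t rfl
      rw [if_pos (by linarith), div_self hν.ne', Path.extend_one, sub_self, zero_mul, zero_div, e0]
  refine ⟨⟨⟨fun t => K t, hKc.comp continuous_subtype_val⟩, ?_, ?_⟩, fun t => ?_⟩
  · show K ((0 : unitInterval) : ℝ) = x₀
    simp [hK, hν.le]
  · show K ((1 : unitInterval) : ℝ) = y₀
    have a1 : ¬ (1 : ℝ) ≤ ν := by linarith
    have a2 : ¬ (1 : ℝ) ≤ 1 - ν := by linarith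
    simp [hK, a1, hν]
  · show (dist (K t) x₀ < ε ∧ _) ∨ (∃ u ∈ Icc 0 M, K t = h u ∧ _) ∨ (dist (K t) y₀ < ε ∧ _)
    by_cases c1 : (t : ℝ) ≤ ν
    · refine Or.inl ⟨?_, c1⟩
      rw [hK]
      simp only [c1, if_true]
      exact hc _
    by_cases c2 : (t : ℝ) ≤ 1 - ν
    · refine Or.inr (Or.inl ⟨(t - ν) * M / (1 - 2 * ν), ?_, ?_, ?_⟩)
      · rw [not_le] at c1
        refine ⟨div_nonneg (mul_nonneg (by linarith) hM) hw.le, ?_⟩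
        rw [div_le_iff₀ hw]
        nlinarith
      · rw [hK]
        simp only [c1, c2, if_true, if_false]
        apply hHe
        rw [not_le] at c1
        refine ⟨div_nonneg (mul_nonneg (by linarith) hM) hw.le, ?_⟩
        rw [div_le_iff₀ hw]
        nlinarith
      · have a1 : (t - ν) * M / (1 - 2 * ν) - M * t = M * ν * (2 * t - 1) / (1 - 2 * ν) := by
          rw [eq_div_iff hw.ne', sub_mul, div_mul_cancel₀ _ hw.ne']
          ring
        have a2 : |2 * (t : ℝ) - 1| ≤ 1 := by
          rw [abs_le]
          constructor <;> linarith [t.2.1, t.2.2]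
        rw [a1, abs_div, abs_mul, abs_of_nonneg (mul_nonneg hM hν.le), abs_of_pos hw,
          div_le_iff₀ hw]
        have a3 : 0 ≤ M * ν := mul_nonneg hM hν.le
        nlinarith [mul_le_mul_of_nonneg_left a2 a3]
    · refine Or.inr (Or.inr ⟨?_, by linarith⟩)
      rw [hK]
      simp only [c1, c2, if_false]
      exact hd _

/-- In a simply connected covering of a nonpositively curved space, geodesic segments with nearby
ends are close to each other. -/
lemma exists_geodesic_stability {X S : Type*} [MetricSpace X] [MetricSpace S] {R : ℝ}
    (hR : 0 < R) (hCN : IsUniformlyCN S R) (hS : IsLengthSpace S) (U : UnivCover X S)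
    {x₀ y₀ : X} {L : ℝ} (hL : 0 ≤ L) {g : ℝ → X}
    (hg : ∀ u ∈ Icc 0 L, ∀ v ∈ Icc 0 L, dist (g u) (g v) = |u - v|)
    (hg0 : g 0 = x₀) (hgL : g L = y₀) {κ : ℝ} (hκ : 0 < κ) :
    ∃ ε > 0, ∀ x y : X, dist x x₀ < ε → dist y y₀ < ε → ∀ (M : ℝ) (h : ℝ → X), 0 ≤ M →
      (∀ u ∈ Icc 0 M, ∀ v ∈ Icc 0 M, dist (h u) (h v) = |u - v|) → h 0 = x → h M = y →
      ∀ t ∈ Icc (0 : ℝ) 1, dist (g (L * t)) (h (M * t)) ≤ κ := by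
  have := U.simplyConnected
  have hpc : Continuous U.p := U.covering.continuous
  have ho : IsOpenMap U.p := U.covering.isOpenMap
  have compact : ∀ {l : ℝ} {c : ℝ → X},
      (∀ u ∈ Icc 0 l, ∀ v ∈ Icc 0 l, dist (c u) (c v) = |u - v|) → IsCompact (c '' Icc 0 l) :=
    fun hc => isCompact_Icc.image_of_continuousOn (continuousOn_of_dist_eq hc)
  have scaled : ∀ {l t : ℝ}, 0 ≤ l → t ∈ Icc (0 : ℝ) 1 → l * t ∈ Icc 0 l := fun hl ht =>
    ⟨mul_nonneg hl ht.1, mul_le_of_le_one_right hl ht.2⟩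
  obtain ⟨kg, hkg, hgiso⟩ := U.localIso.exists_uniform (compact hg)
  have hgmem : ∀ u ∈ Icc 0 L, g u ∈ g '' Icc 0 L := fun u hu => mem_image_of_mem g hu
  obtain ⟨ka, hka, hpatha⟩ := U.localIso.exists_path ho hS x₀
  obtain ⟨kb, hkb, hpathb⟩ := U.localIso.exists_path ho hS y₀
  set δ : ℝ := R / 5 with hδdef
  have hδ0 : 0 < δ := by positivity
  have hδ : 4 * δ < R := by rw [hδdef]; linarith
  set κ' : ℝ := min κ (min δ (kg / 2)) with hκ'
  have hκ'0 : 0 < κ' := lt_min hκ (lt_min hδ0 (by positivity))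
  have hκ'δ : κ' ≤ δ := (min_le_right _ _).trans (min_le_left _ _)
  have hκ'g : κ' ≤ kg / 2 := (min_le_right _ _).trans (min_le_right _ _)
  set ε : ℝ := min (κ' / 4) (min ka kb) with hε
  have hε0 : 0 < ε := lt_min (by positivity) (lt_min hka hkb)
  have hεκ : ε ≤ κ' / 4 := min_le_left _ _
  have hεa : ε ≤ ka := (min_le_right _ _).trans (min_le_left _ _)
  have hεb : ε ≤ kb := (min_le_right _ _).trans (min_le_right _ _)
  refine ⟨ε, hε0, fun x y hx hy M h hM hh h0 hhM => ?_⟩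
  obtain ⟨c, hc⟩ := hpatha ε hεa x hx
  obtain ⟨d, hd⟩ := hpathb ε hεb y hy
  obtain ⟨kh, hkh, hhiso⟩ := U.localIso.exists_uniform (compact hh)
  have local_iso : ∀ {l k : ℝ} {f : ℝ → X}, 0 < k →
      (∀ u ∈ Icc 0 l, ∀ v ∈ Icc 0 l, dist (f u) (f v) = |u - v|) →
      (∀ a ∈ f '' Icc 0 l, ∀ y ∈ ball a k, ∀ z ∈ ball a k, dist (U.p y) (U.p z) = dist y z) →
      ∀ u ∈ Icc 0 l, ∀ v ∈ Icc 0 l, |u - v| < k → dist (U.p (f u)) (U.p (f v)) = |u - v| := by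
    intro l k f hk hf hfi u hu v hv huv
    rw [hfi (f u) (mem_image_of_mem f hu) _ (mem_ball_self hk) _
      (mem_ball.2 (by rwa [dist_comm, hf u hu v hv])), hf u hu v hv]
  have hgl := local_iso hkg hg hgiso
  have hhl := local_iso hkh hh hhiso
  have speed : ∀ {l k η : ℝ} {f : ℝ → X}, 0 ≤ l → 0 < k → η * (l + 1) ≤ k →
      (∀ u ∈ Icc 0 l, ∀ v ∈ Icc 0 l, |u - v| < k → dist (U.p (f u)) (U.p (f v)) = |u - v|) →
      ∀ a ∈ Icc (0 : ℝ) 1, ∀ b ∈ Icc (0 : ℝ) 1, |a - b| < η →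
        dist (U.p (f (l * a))) (U.p (f (l * b))) = l * |a - b| := by
    intro l k η f hl hk hη hf a ha b hb hab
    have e : |l * a - l * b| = l * |a - b| := by rw [← mul_sub, abs_mul, abs_of_nonneg hl]
    rw [hf _ (scaled hl ha) _ (scaled hl hb), e]
    rw [e]
    nlinarith [abs_nonneg (a - b)]
  set ν : ℝ := min (1 / 4) (min (kh / (4 * (M + 1))) (κ' / (4 * (M + 1)))) with hνdef
  have hM1 : 0 < 4 * (M + 1) := by linarith
  have hν0 : 0 < ν := lt_min (by norm_num) (lt_min (by positivity) (by positivity))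
  have hν1 : ν ≤ kh / (4 * (M + 1)) := (min_le_right _ _).trans (min_le_left _ _)
  have hν2 : ν ≤ κ' / (4 * (M + 1)) := (min_le_right _ _).trans (min_le_right _ _)
  rw [le_div_iff₀ hM1] at hν1 hν2
  obtain ⟨k, hk⟩ := exists_path_near_geodesic hM hh h0 hhM c hc d hd hν0 (min_le_left _ _)
  have close : ∀ t : unitInterval, dist (U.p (k t)) (U.p (h (M * t))) ≤ κ' := by
    intro t
    have htM := scaled hM t.2
    have near : ∀ (z : X) (w : ℝ), w ∈ Icc 0 L → g w = z → ∀ v ∈ Icc 0 M, dist (h v) z < ε →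
        |v - M * t| ≤ M * ν → dist (k t) z < ε → dist (U.p (k t)) (U.p (h (M * t))) ≤ κ' := by
      intro z w hw hwz v hv hvz hvt hkz
      have i1 := hgiso z (hwz ▸ hgmem w hw) (k t) (mem_ball.2 (by linarith)) z (mem_ball_self hkg)
      have i2 := hgiso z (hwz ▸ hgmem w hw) z (mem_ball_self hkg) (h v) (mem_ball.2 (by linarith))
      have i3 := hhl v hv _ htM (by nlinarith)
      rw [dist_comm z] at i2
      have := dist_triangle4 (U.p (k t)) (U.p z) (U.p (h v)) (U.p (h (M * t)))
      rw [i1, i2, i3] at this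
      nlinarith
    rcases hk t with ⟨h1, h2⟩ | ⟨u, hu, h1, h2⟩ | ⟨h1, h2⟩
    · refine near x₀ 0 ⟨le_rfl, hL⟩ hg0 0 ⟨le_rfl, hM⟩ (by rwa [h0]) ?_ h1
      rw [zero_sub, abs_neg, abs_of_nonneg htM.1]
      exact mul_le_mul_of_nonneg_left h2 hM
    · rw [h1, hhl u hu _ htM (by nlinarith)]
      nlinarith
    · refine near y₀ L ⟨hL, le_rfl⟩ hgL M ⟨hM, le_rfl⟩ (by rwa [hhM]) ?_ h1
      rw [abs_of_nonneg (by linarith [htM.2])]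
      nlinarith
  have hgc : ContinuousOn (fun t : ℝ => g (L * t)) (Icc 0 1) :=
    (continuousOn_of_dist_eq hg).comp (by fun_prop) (fun t ht => scaled hL ht)
  have hhc : ContinuousOn (fun t : ℝ => h (M * t)) (Icc 0 1) :=
    (continuousOn_of_dist_eq hh).comp (by fun_prop) (fun t ht => scaled hM ht)
  set γ : Path x₀ y₀ :=
    { toFun := fun t => g (L * t)
      continuous_toFun := hgc.domRestrict
      source' := by simp [hg0]
      target' := by simp [hgL] } with hγ
  obtain ⟨H⟩ := SimplyConnectedSpace.paths_homotopic γ k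
  have h01 : (0 : ℝ) ≤ 1 := zero_le_one
  set F : ℝ × ℝ → S := fun q => U.p (H (projIcc 0 1 h01 q.1, projIcc 0 1 h01 q.2)) with hFdef
  have hFu : UniformContinuous F := by
    have h1 : UniformContinuous fun q : unitInterval × unitInterval => U.p (H q) :=
      CompactSpace.uniformContinuous_of_continuous (hpc.comp H.continuous)
    have h2 := (LipschitzWith.projIcc h01).uniformContinuous
    exact h1.comp ((h2.comp uniformContinuous_fst).prodMk (h2.comp uniformContinuous_snd))
  have F0 : ∀ t ∈ Icc (0 : ℝ) 1, F (0, t) = U.p (g (L * t)) := by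
    intro t ht
    simp only [hFdef]
    rw [projIcc_left, projIcc_of_mem h01 ht]
    exact congrArg U.p (H.apply_zero _)
  have F1 : ∀ (t : ℝ) (ht : t ∈ Icc (0 : ℝ) 1), F (1, t) = U.p (k ⟨t, ht⟩) := by
    intro t ht
    simp only [hFdef]
    rw [projIcc_right, projIcc_of_mem h01 ht]
    exact congrArg U.p (H.apply_one _)
  have Fs : ∀ σ, F (σ, 0) = U.p x₀ := by
    intro σ
    simp only [hFdef]
    rw [projIcc_left]
    exact congrArg U.p (H.source _)
  have Ft : ∀ σ, F (σ, 1) = U.p y₀ := by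
    intro σ
    simp only [hFdef]
    rw [projIcc_right]
    exact congrArg U.p (H.target _)
  set η : ℝ := min (kg / (L + 1)) (kh / (M + 1)) with hηdef
  have hL1 : 0 < L + 1 := by linarith
  have hM1' : 0 < M + 1 := by linarith
  have hη0 : 0 < η := lt_min (by positivity) (by positivity)
  have hηg : η * (L + 1) ≤ kg := (le_div_iff₀ hL1).1 (min_le_left _ _)
  have hηh : η * (M + 1) ≤ kh := (le_div_iff₀ hM1').1 (min_le_right _ _)
  have proj : ∀ t ∈ Icc (0 : ℝ) 1, dist (U.p (g (L * t))) (U.p (h (M * t))) ≤ κ' := by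
    intro t ht
    rw [← F0 t ht]
    refine dist_le_of_homotopy hCN hδ hδ0 hκ'δ hFu (fun σ => by rw [Fs, Fs])
      (fun σ => by rw [Ft, Ft]) (b := fun t => U.p (h (M * t))) (v := L) (v' := M) hη0 ?_ ?_ ?_ ht
    · intro a ha b hb hab
      rw [F0 a ha, F0 b hb]
      exact speed hL hkg hηg hgl a ha b hb hab
    · exact speed hM hkh hηh hhl
    · intro t ht
      rw [F1 t ht]
      exact close ⟨t, ht⟩
  have gap : ∀ t ∈ Icc (0 : ℝ) 1, dist (g (L * t)) (h (M * t)) < kg →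
      dist (g (L * t)) (h (M * t)) ≤ κ' := by
    intro t ht hlt
    have := hgiso _ (hgmem _ (scaled hL ht)) _ (mem_ball_self hkg) (h (M * t))
      (mem_ball.2 (by rwa [dist_comm]))
    rw [← this]
    exact proj t ht
  intro t ht
  refine le_trans ?_ (min_le_left κ (min δ (kg / 2)))
  by_contra! hlt
  have hcont : ContinuousOn (fun t : ℝ => dist (g (L * t)) (h (M * t))) (Icc 0 t) :=
    (continuous_dist.comp_continuousOn (hgc.prodMk hhc)).mono (Icc_subset_Icc_right ht.2)
  have start : dist (g (L * 0)) (h (M * 0)) < κ' := by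
    rw [mul_zero, mul_zero, hg0, h0, dist_comm]
    linarith
  set w : ℝ := min (dist (g (L * t)) (h (M * t))) (3 * kg / 4) with hwdef
  have hw1 : κ' < w := lt_min hlt (by linarith)
  have hw2 : w ≤ 3 * kg / 4 := min_le_right _ _
  obtain ⟨r, hr, hrw⟩ := intermediate_value_Icc ht.1 hcont
    ⟨(start.trans hw1).le, min_le_left _ _⟩
  simp only at hrw
  have := gap r ⟨hr.1, hr.2.trans ht.2⟩ (by rw [hrw]; linarith)
  rw [hrw] at this
  linarith

lemma coneDist_zero (θ t : ℝ) {q : ℝ × ℝ} (hq : 0 ≤ q.1) : coneDist θ q (0, t) = q.1 := by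
  simp [coneDist_eq_sqrt θ (q := (0, t)) hq le_rfl, sqrt_sq hq]

lemma abs_fst_eq_coneDist_zero {θ : ℝ} {q : ℝ × ℝ} {t : ℝ} (h : 0 ≤ coneDist θ q (0, t)) :
    |q.1| = coneDist θ q (0, t) := by
  unfold coneDist at h ⊢
  split_ifs at h ⊢ with hc
  · rw [add_zero] at h ⊢
    exact abs_of_nonneg h
  · simp [sqrt_sq_eq_abs]

/-- Near a conical point of angle greater than `2π`, every other point has two antipodes. -/
lemma IsConicalPoint.exists_antipodes {S : Type*} [MetricSpace S] {θ : ℝ} (hθ : 2 * π < θ) {a : S}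
    (h : IsConicalPoint θ a) : ∃ ε > 0, ∀ p ∈ ball a ε, p ≠ a → ∃ q₁ q₂, q₁ ≠ q₂ ∧
      dist q₁ a = dist p a ∧ dist q₂ a = dist p a ∧
      dist p q₁ = 2 * dist p a ∧ dist p q₂ = 2 * dist p a := by
  have hpi := pi_pos
  have hθ0 : 0 < θ := by linarith
  obtain ⟨ε, hε, F, hFa, hF0, hd, hs⟩ := h
  refine ⟨ε, hε, fun p hp hpa => ?_⟩
  have ha : a ∈ ball a ε := mem_ball_self hε
  have hrad : ∀ q ∈ ball a ε, dist q a = (F q).1 := fun q hq => by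
    rw [← hd q hq a ha, hFa, coneDist_zero θ 0 (hF0 q hq).1]
  have hr : 0 < (F p).1 := by rw [← hrad p hp]; exact dist_pos.2 hpa
  have hrε := (hF0 p hp).2
  have key : ∀ t, π ≤ circleDist θ (F p).2 t → ∀ q ∈ ball a ε,
      coneDist θ (F q) ((F p).1, t) = 0 →
      dist q a = dist p a ∧ dist p q = 2 * dist p a ∧ circleDist θ (F q).2 t = 0 := by
    intro t ht q hq h0
    obtain ⟨h1, h2⟩ := fst_eq_of_coneDist_eq_zero (q := ((F p).1, t)) (hF0 q hq).1 hr.le h0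
    refine ⟨by rw [hrad q hq, hrad p hp, h1], ?_, h2.resolve_left hr.ne'⟩
    rw [← hd p hp q hq, coneDist_congr hθ0 (q := ((F p).1, t)) (hF0 q hq).1 hr.le h0 hr.le,
      coneDist, if_pos ht, hrad p hp, two_mul]
  have c1 : π ≤ circleDist θ (F p).2 ((F p).2 + π) := by
    have h := circleDist_eq_or_ge hθ0 (F p).2 ((F p).2 + π) 0
    have e : |(F p).2 - ((F p).2 + π) - θ * ((0 : ℤ) : ℝ)| = π := by
      rw [show (F p).2 - ((F p).2 + π) - θ * ((0 : ℤ) : ℝ) = -π by push_cast; ring, abs_neg,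
        abs_of_pos hpi]
    rw [e] at h
    rcases h with h | h <;> linarith
  have c2 : π ≤ circleDist θ (F p).2 ((F p).2 + θ / 2) := by
    have h := circleDist_eq_or_ge hθ0 (F p).2 ((F p).2 + θ / 2) 0
    have e : |(F p).2 - ((F p).2 + θ / 2) - θ * ((0 : ℤ) : ℝ)| = θ / 2 := by
      rw [show (F p).2 - ((F p).2 + θ / 2) - θ * ((0 : ℤ) : ℝ) = -(θ / 2) by push_cast; ring,
        abs_neg, abs_of_pos (by linarith)]
    rw [e] at h
    rcases h with h | h <;> linarith
  have c3 : 0 < circleDist θ ((F p).2 + θ / 2) ((F p).2 + π) := by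
    have h := circleDist_eq_or_ge hθ0 ((F p).2 + θ / 2) ((F p).2 + π) 0
    have e : |(F p).2 + θ / 2 - ((F p).2 + π) - θ * ((0 : ℤ) : ℝ)| = θ / 2 - π := by
      rw [show (F p).2 + θ / 2 - ((F p).2 + π) - θ * ((0 : ℤ) : ℝ) = θ / 2 - π by
        push_cast; ring, abs_of_pos (by linarith)]
    rw [e] at h
    rcases h with h | h <;> linarith
  obtain ⟨q₁, hq₁, h₁⟩ := hs (F p).1 ((F p).2 + π) hr.le hrε
  obtain ⟨q₂, hq₂, h₂⟩ := hs (F p).1 ((F p).2 + θ / 2) hr.le hrε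
  obtain ⟨a₁, b₁, e₁⟩ := key _ c1 q₁ hq₁ h₁
  obtain ⟨a₂, b₂, e₂⟩ := key _ c2 q₂ hq₂ h₂
  refine ⟨q₁, q₂, ?_, a₁, a₂, b₁, b₂⟩
  rintro rfl
  have := circleDist_triangle hθ0 ((F p).2 + θ / 2) (F q₁).2 ((F p).2 + π)
  rw [circleDist_comm hθ0 _ (F q₁).2] at this
  linarith

lemma fst_eq_neg_of_coneDist_eq {θ : ℝ} {p q : ℝ × ℝ} (hp : p.1 < 0) (hq : |q.1| = -p.1)
    (h : coneDist θ p q = 2 * -p.1) : q.1 = -p.1 ∧ circleDist θ p.2 q.2 = 0 := by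
  unfold coneDist at h
  have hqle := le_abs_self q.1
  split_ifs at h with hc
  · linarith
  rw [not_le] at hc
  have hc0 := circleDist_nonneg θ p.2 q.2
  have h1 := (sqrt_eq_iff_mul_self_eq_of_pos (by linarith)).1 h
  rcases abs_choice q.1 with hch | hch <;> rw [hch] at hq
  · rw [hq] at h1
    refine ⟨hq, ?_⟩
    have h2 : p.1 ^ 2 * (cos (circleDist θ p.2 q.2) - 1) = 0 := by nlinarith
    have h3 : cos (circleDist θ p.2 q.2) = cos 0 := by
      have := (mul_eq_zero.1 h2).resolve_left (pow_ne_zero 2 hp.ne)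
      rw [cos_zero]; linarith
    exact injOn_cos ⟨hc0, hc.le⟩ ⟨le_rfl, pi_pos.le⟩ h3
  · have hq' : q.1 = p.1 := by linarith
    rw [hq'] at h1
    have h2 : p.1 ^ 2 * (cos (circleDist θ p.2 q.2) + 1) = 0 := by nlinarith
    have h3 : cos (circleDist θ p.2 q.2) = cos π := by
      have := (mul_eq_zero.1 h2).resolve_left (pow_ne_zero 2 hp.ne)
      rw [cos_pi]; linarith
    have := injOn_cos ⟨hc0, hc.le⟩ ⟨pi_pos.le, le_rfl⟩ h3
    linarith

/-- A cone chart around a lift of a conical point has nonnegative radial coordinates near it. -/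
lemma exists_coneChart_nonneg {X S : Type*} [MetricSpace X] [MetricSpace S] (U : UnivCover X S)
    {s : X} {θ : ℝ} (hθ : 2 * π < θ) (hs : IsConicalPoint θ (U.p s)) {ρ : ℝ} (hρ : 0 < ρ)
    {f : X → ℝ × ℝ} (hf0 : f s = (0, 0))
    (hchart : ∀ p ∈ ball s ρ, ∀ q ∈ ball s ρ, coneDist θ (f p) (f q) = dist p q) :
    ∃ δ > 0, δ ≤ ρ ∧ ∀ p ∈ ball s δ, 0 ≤ (f p).1 := by
  have hθ0 : 0 < θ := by linarith [pi_pos]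
  obtain ⟨ε, hε, hanti⟩ := hs.exists_antipodes hθ
  obtain ⟨κ, hκ, hiso, hlift⟩ := U.localIso.exists_lift_ball U.covering.isOpenMap s
  refine ⟨min ρ (min ε κ), lt_min hρ (lt_min hε hκ), min_le_left _ _, fun p hp => ?_⟩
  have hpρ : p ∈ ball s ρ := ball_subset_ball (min_le_left _ _) hp
  have hpε : dist p s < ε := (mem_ball.1 hp).trans_le ((min_le_right _ _).trans (min_le_left _ _))
  have hpκ : p ∈ ball s κ := ball_subset_ball ((min_le_right _ _).trans (min_le_right _ _)) hp
  have hsρ : s ∈ ball s ρ := mem_ball_self hρ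
  have hsκ : s ∈ ball s κ := mem_ball_self hκ
  have hrad : ∀ q ∈ ball s ρ, |(f q).1| = dist q s := fun q hq => by
    have h := hchart q hq s hsρ
    rw [hf0] at h
    rw [abs_fst_eq_coneDist_zero (h ▸ dist_nonneg), h]
  by_contra! hneg
  have hr : dist p s = -(f p).1 := by rw [← hrad p hpρ, abs_of_neg hneg]
  have hps : dist (U.p p) (U.p s) = dist p s := hiso p hpκ s hsκ
  obtain ⟨q₁, q₂, hne, a₁, a₂, b₁, b₂⟩ := hanti (U.p p) (mem_ball.2 (by rwa [hps]))
    (dist_pos.1 (by rw [hps]; linarith))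
  rw [hps] at a₁ a₂ b₁ b₂
  have key : ∀ q, dist q (U.p s) = dist p s → dist (U.p p) q = 2 * dist p s →
      ∃ x ∈ ball s ρ, U.p x = q ∧ (f x).1 = -(f p).1 ∧ circleDist θ (f p).2 (f x).2 = 0 := by
    intro q hq hpq
    obtain ⟨x, rfl, hx⟩ := hlift q (by rw [hq]; exact hpκ)
    rw [hq] at hx
    have hxρ : x ∈ ball s ρ := mem_ball.2 (hx ▸ hpρ)
    have hxκ : x ∈ ball s κ := mem_ball.2 (hx ▸ hpκ)
    refine ⟨x, hxρ, rfl, fst_eq_neg_of_coneDist_eq hneg (by rw [hrad x hxρ, hx, hr]) ?_⟩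
    rw [hchart p hpρ x hxρ, ← hiso p hpκ x hxκ, hpq, hr]
  obtain ⟨x₁, m₁, rfl, r₁, c₁⟩ := key q₁ a₁ b₁
  obtain ⟨x₂, m₂, rfl, r₂, c₂⟩ := key q₂ a₂ b₂
  refine hne (congrArg U.p (dist_eq_zero.1 ?_))
  have hc : circleDist θ (f x₁).2 (f x₂).2 = 0 := by
    rw [← circleDist_congr hθ0 c₂, circleDist_comm hθ0, c₁]
  rw [← hchart x₁ m₁ x₂ m₂, coneDist_eq_sqrt θ (by linarith) (by linarith), coneCos, hc, r₁, r₂,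
    min_eq_right pi_pos.le, cos_zero]
  ring_nf
  exact sqrt_zero

/-- In a cone, a point lying between two points whose angle at the vertex exceeds `π`, at the
distance of the vertex from both, is the vertex. -/
lemma fst_eq_zero_of_coneDist_eq {θ : ℝ} (hθ : 0 < θ) {p q z : ℝ × ℝ} (hp : 0 ≤ p.1)
    (hq : 0 ≤ q.1) (hz : 0 ≤ z.1) (hpq : π < circleDist θ p.2 q.2)
    (h₁ : coneDist θ p z = p.1) (h₂ : coneDist θ z q = q.1) : z.1 = 0 := by
  by_contra hne
  have hz0 : 0 < z.1 := lt_of_le_of_ne hz (Ne.symm hne)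
  have hpi := pi_pos
  have e₁ := coneDist_sq θ hp hz
  have e₂ := coneDist_sq θ hz hq
  rw [h₁] at e₁
  rw [h₂] at e₂
  have k₁ : circleDist θ p.2 z.2 < π / 2 := by
    by_contra! hc
    have := coneCos_le_cos_of_le (by linarith) (by linarith) hc
    rw [cos_pi_div_two] at this
    nlinarith [mul_nonneg (mul_nonneg hp hz) (neg_nonneg.2 this)]
  have k₂ : circleDist θ z.2 q.2 < π / 2 := by
    by_contra! hc
    have := coneCos_le_cos_of_le (by linarith) (by linarith) hc
    rw [cos_pi_div_two] at this
    nlinarith [mul_nonneg (mul_nonneg hz hq) (neg_nonneg.2 this)]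
  linarith [circleDist_triangle hθ p.2 z.2 q.2]

lemma circleDist_lt_of_coneDist_lt {θ ω η α : ℝ} {p : ℝ × ℝ} (hp : 0 ≤ p.1) (hη : 0 < η)
    (hω : 0 < ω) (hω' : ω ≤ π / 2) (h : coneDist θ p (η, α) < η * sin ω) :
    circleDist θ p.2 α < ω := by
  by_contra! hc
  have hpi := pi_pos
  have h1 := coneDist_sq θ (q := (η, α)) hp hη.le
  have h2 := coneCos_le_cos_of_le hω.le (by linarith) hc
  have h0 : 0 ≤ coneDist θ p (η, α) := by
    rw [coneDist_eq_sqrt θ hp hη.le]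
    exact sqrt_nonneg _
  have h3 := mul_self_lt_mul_self h0 h
  have h4 := mul_le_mul_of_nonneg_left h2 (mul_nonneg hp hη.le)
  simp only at h1
  nlinarith [sq_nonneg (p.1 - η * cos ω), sin_sq_add_cos_sq ω]

/-- in the universal cover of a closed e.s.c.s. with all cone angles
`> 2π`, if a geodesic segment `[x₀,y₀]` passes through a conical point `s` (of cone
angle `θs`), and both angles subtended at `s` by the two subsegments (computed in a
cone chart `f` around `s`, where `α` and `β` are the angular coordinates of the
incoming and outgoing directions) are strictly bigger than `π`, then all geodesic
segments between points sufficiently close to `x₀` and `y₀` pass through `s`. -/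
theorem geodesics_near_double_obtuse_cone_point
    {S : Type*} [MetricSpace S] [CompactSpace S] [ConnectedSpace S]
    (E : ESCS S) (hbig : E.BigAngles)
    {X : Type*} [MetricSpace X] (U : UnivCover X S)
    (s : X) (θs : ℝ) (hθ : 2 * Real.pi < θs)
    (hproj : U.p s ∈ E.conePts ∧ E.angle (U.p s) = θs)
    (ρ : ℝ) (hρ : 0 < ρ) (f : X → ℝ × ℝ) (hf0 : f s = (0, 0))
    (hchart : ∀ p ∈ ball s ρ, ∀ q ∈ ball s ρ, coneDist θs (f p) (f q) = dist p q)
    (x₀ y₀ : X) (L ts : ℝ) (g : ℝ → X)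
    (hg : ∀ u ∈ Set.Icc 0 L, ∀ v ∈ Set.Icc 0 L, dist (g u) (g v) = |u - v|)
    (hg0 : g 0 = x₀) (hgL : g L = y₀)
    (hts : 0 < ts) (htsL : ts < L) (hgs : g ts = s)
    (α β μ : ℝ) (hμ : 0 < μ) (hμρ : μ ≤ ρ)
    (hin : ∀ t : ℝ, ts - μ < t → t < ts → coneDist θs (f (g t)) (ts - t, α) = 0)
    (hout : ∀ t : ℝ, ts < t → t < ts + μ → coneDist θs (f (g t)) (t - ts, β) = 0)
    (hangle1 : Real.pi < circleDist θs α β)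
    (hangle2 : Real.pi < θs - circleDist θs α β) :
    ∃ ε > 0, ∀ x y : X, dist x x₀ < ε → dist y y₀ < ε →
      ∀ (M : ℝ) (h : ℝ → X), 0 ≤ M →
        (∀ u ∈ Set.Icc 0 M, ∀ v ∈ Set.Icc 0 M, dist (h u) (h v) = |u - v|) →
        h 0 = x → h M = y → ∃ t ∈ Set.Icc 0 M, h t = s := by
  have hpi := pi_pos
  have hθ0 : 0 < θs := by linarith
  have hL : 0 < L := hts.trans htsL
  obtain ⟨R, hR, hCN⟩ := exists_isUniformlyCN fun a : S => by
    by_cases ha : a ∈ E.conePts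
    · exact (E.conical a ha).isLocallyCNAt (hbig a ha).le
    · exact (E.regular a ha).isLocallyCNAt
  obtain ⟨δ, hδ, hδρ, hpos⟩ := exists_coneChart_nonneg U hθ
    (hproj.2 ▸ E.conical _ hproj.1) hρ hf0 hchart
  have hd : ∀ p ∈ ball s δ, ∀ q ∈ ball s δ, coneDist θs (f p) (f q) = dist p q :=
    fun p hp q hq => hchart p (ball_subset_ball hδρ hp) q (ball_subset_ball hδρ hq)
  have hrad : ∀ p ∈ ball s δ, (f p).1 = dist p s := fun p hp => by
    rw [← hd p hp s (mem_ball_self hδ), hf0, coneDist_zero θs 0 (hpos p hp)]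
  set C := circleDist θs α β with hC
  obtain ⟨ω, hω, hω', hωC⟩ : ∃ ω, 0 < ω ∧ ω ≤ π / 2 ∧ 2 * ω ≤ C - π :=
    ⟨min (π / 2) ((C - π) / 2), lt_min (by linarith) (by linarith), min_le_left _ _,
      by linarith [min_le_right (π / 2) ((C - π) / 2)]⟩
  obtain ⟨η, hη, hημ, hηt, hηL, hηδ⟩ :
      ∃ η, 0 < η ∧ η < μ ∧ η < ts ∧ η < L - ts ∧ 4 * η < δ := by
    obtain ⟨η, h0, h1⟩ := exists_between
      (show 0 < min (min μ ts) (min (L - ts) (δ / 4)) from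
        lt_min (lt_min hμ hts) (lt_min (by linarith) (by linarith)))
    simp only [lt_min_iff] at h1
    exact ⟨η, h0, h1.1.1, h1.1.2, h1.2.1, by linarith [h1.2.2]⟩
  have hsin : 0 < sin ω := sin_pos_of_pos_of_lt_pi hω (by linarith)
  have hκ : 0 < η * sin ω / 2 := by positivity
  have hκη : η * sin ω / 2 ≤ η / 2 := by
    linarith [mul_le_of_le_one_right hη.le (sin_le_one ω)]
  obtain ⟨ε, hε, hstab⟩ :=
    exists_geodesic_stability hR hCN E.lengthMetric U hL.le hg hg0 hgL hκ
  refine ⟨ε, hε, fun x y hx hy M h hM hh hh0 hhM => ?_⟩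
  have hclose := hstab x y hx hy M h hM hh hh0 hhM
  have hunit : ∀ v ∈ Icc 0 L, v / L ∈ Icc (0 : ℝ) 1 := fun v hv =>
    ⟨div_nonneg hv.1 hL.le, div_le_one_of_le₀ hv.2 hL.le⟩
  have near : ∀ v ∈ Icc 0 L, |v - ts| = η → ∀ γ, coneDist θs (f (g v)) (η, γ) = 0 →
      h (M * (v / L)) ∈ ball s δ ∧ dist (h (M * (v / L))) s ≤ 3 * η / 2 ∧
        circleDist θs (f (h (M * (v / L)))).2 γ < ω := by
    intro v hv hvt γ hγ
    have hgv : dist (g v) s = η := by rw [← hgs, hg v hv ts ⟨hts.le, htsL.le⟩, hvt]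
    have hgvm : g v ∈ ball s δ := mem_ball.2 (by linarith)
    have hcl := hclose _ (hunit v hv)
    rw [mul_div_cancel₀ v hL.ne', dist_comm] at hcl
    have hds : dist (h (M * (v / L))) s ≤ 3 * η / 2 := by
      linarith [dist_triangle (h (M * (v / L))) (g v) s]
    have hm : h (M * (v / L)) ∈ ball s δ := mem_ball.2 (by linarith)
    refine ⟨hm, hds, circleDist_lt_of_coneDist_lt (hpos _ hm) hη hω hω' ?_⟩
    rw [← coneDist_congr hθ0 (q := (η, γ)) (hpos _ hgvm) hη.le hγ (hpos _ hm), hd _ hm _ hgvm]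
    linarith
  have hv₁ : ts - η ∈ Icc 0 L := ⟨by linarith, by linarith⟩
  have hv₂ : ts + η ∈ Icc 0 L := ⟨by linarith, by linarith⟩
  have hin' := hin (ts - η) (by linarith) (by linarith)
  have hout' := hout (ts + η) (by linarith) (by linarith)
  rw [sub_sub_cancel] at hin'
  rw [add_sub_cancel_left] at hout'
  obtain ⟨hP, hPs, hPα⟩ := near _ hv₁ (by rw [sub_sub_cancel_left, abs_neg, abs_of_pos hη]) α hin'
  obtain ⟨hQ, hQs, hQβ⟩ := near _ hv₂ (by rw [add_sub_cancel_left, abs_of_pos hη]) β hout'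
  set u₁ := M * ((ts - η) / L) with hu₁
  set u₂ := M * ((ts + η) / L) with hu₂
  have hu₁M : u₁ ∈ Icc 0 M :=
    ⟨mul_nonneg hM (hunit _ hv₁).1, mul_le_of_le_one_right hM (hunit _ hv₁).2⟩
  have hu₂M : u₂ ∈ Icc 0 M :=
    ⟨mul_nonneg hM (hunit _ hv₂).1, mul_le_of_le_one_right hM (hunit _ hv₂).2⟩
  have hu₁₂ : u₁ ≤ u₂ :=
    mul_le_mul_of_nonneg_left (div_le_div_of_nonneg_right (by linarith) hL.le) hM
  have hangle : π < circleDist θs (f (h u₁)).2 (f (h u₂)).2 := by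
    have t₁ := circleDist_triangle hθ0 α (f (h u₁)).2 β
    have t₂ := circleDist_triangle hθ0 (f (h u₁)).2 (f (h u₂)).2 β
    rw [circleDist_comm hθ0 α (f (h u₁)).2] at t₁
    linarith
  have hPQ : u₂ - u₁ = dist (h u₁) s + dist (h u₂) s := by
    rw [← hrad _ hP, ← hrad _ hQ, ← abs_of_nonneg (sub_nonneg.2 hu₁₂), ← hh u₂ hu₂M u₁ hu₁M,
      dist_comm, ← hd _ hP _ hQ, coneDist, if_pos hangle.le]
  have hr₁ : 0 ≤ dist (h u₁) s := dist_nonneg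
  have hr₂ : 0 ≤ dist (h u₂) s := dist_nonneg
  have huM : u₁ + dist (h u₁) s ∈ Icc 0 M :=
    ⟨by linarith [hu₁M.1], by linarith [hu₂M.2]⟩
  refine ⟨_, huM, ?_⟩
  have dP : dist (h u₁) (h (u₁ + dist (h u₁) s)) = dist (h u₁) s := by
    rw [hh _ hu₁M _ huM, sub_add_cancel_left, abs_neg, abs_of_nonneg hr₁]
  have dQ : dist (h (u₁ + dist (h u₁) s)) (h u₂) = dist (h u₂) s := by
    rw [hh _ huM _ hu₂M, abs_sub_comm, abs_of_nonneg (by linarith)]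
    linarith
  have hz : h (u₁ + dist (h u₁) s) ∈ ball s δ := by
    have := dist_triangle_left (h (u₁ + dist (h u₁) s)) s (h u₁)
    exact mem_ball.2 (by linarith)
  rw [← dist_eq_zero, ← hrad _ hz]
  exact fst_eq_zero_of_coneDist_eq hθ0 (hpos _ hP) (hpos _ hQ) (hpos _ hz) hangle
    (by rw [hd _ hP _ hz, dP, hrad _ hP]) (by rw [hd _ hz _ hQ, dQ, hrad _ hQ])

end
end

section
/- Let S be a closed e.s.c.s. with all cone angles > 2π and let g be a geodesic in S whose image contains no conical point. Then g is a closed geodesic if and only if the image Im(g) is a closed subset of S. -/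
open Metric Real Set

noncomputable section

section LocalGeodesics

open Filter Topology

/-- An isometric map from an open interval to an inner product space is affine. -/
lemma exists_unit_direction_of_isometric {E : Type*} [NormedAddCommGroup E]
    [InnerProductSpace ℝ E] {φ : ℝ → E} {t η : ℝ} (hη : 0 < η)
    (h : ∀ s ∈ ball t η, ∀ u ∈ ball t η, dist (φ s) (φ u) = |s - u|) :
    ∃ v : E, ‖v‖ = 1 ∧ ∀ u ∈ ball t η, φ u = φ t + (u - t) • v := by
  have ht : t ∈ ball t η := mem_ball_self hη
  have hw : t + η / 2 ∈ ball t η := by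
    rw [mem_ball, Real.dist_eq, add_sub_cancel_left, abs_of_pos (by positivity)]
    linarith
  have hnorm : ∀ u ∈ ball t η, ‖φ u - φ t‖ ^ 2 = (u - t) ^ 2 := by
    intro u hu
    rw [← dist_eq_norm, h u hu t ht, sq_abs]
  have hinner : ∀ u ∈ ball t η, inner ℝ (φ u - φ t) (φ (t + η / 2) - φ t)
      = (u - t) * (η / 2) := by
    intro u hu
    have h1 := norm_sub_sq_real (φ u - φ t) (φ (t + η / 2) - φ t)
    rw [hnorm u hu, hnorm _ hw, sub_sub_sub_cancel_right, ← dist_eq_norm, h u hu _ hw,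
      sq_abs] at h1
    linarith
  refine ⟨(η / 2)⁻¹ • (φ (t + η / 2) - φ t), ?_, fun u hu => ?_⟩
  · rw [norm_smul, ← dist_eq_norm, h _ hw t ht, add_sub_cancel_left, Real.norm_eq_abs, abs_inv,
      inv_mul_cancel₀]
    positivity
  · have h0 : ‖(φ u - φ t) - (u - t) • (η / 2)⁻¹ • (φ (t + η / 2) - φ t)‖ ^ 2 = 0 := by
      rw [norm_sub_sq_real, inner_smul_right, inner_smul_right, hinner u hu, norm_smul,
        norm_smul, mul_pow, mul_pow, hnorm u hu, hnorm _ hw, Real.norm_eq_abs, Real.norm_eq_abs,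
        sq_abs, sq_abs]
      field_simp
      ring
    have h1 := norm_eq_zero.1 (pow_eq_zero_iff two_ne_zero |>.1 h0)
    rw [← sub_eq_zero.1 h1]
    abel

/-- A locally isometric map from an open interval to an inner product space is isometric. -/
lemma dist_eq_of_locally_isometric {E : Type*} [NormedAddCommGroup E]
    [InnerProductSpace ℝ E] {φ : ℝ → E} {t η : ℝ}
    (h : ∀ s ∈ ball t η, ∃ δ > 0, ∀ u ∈ ball s δ, ∀ w ∈ ball s δ, dist (φ u) (φ w) = |u - w|)
    {a b : ℝ} (ha : a ∈ ball t η) (hb : b ∈ ball t η) : dist (φ a) (φ b) = |a - b| := by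
  have key : ∀ s ∈ ball t η, ∃ v : E, ‖v‖ = 1 ∧ ∀ᶠ u in 𝓝 s, HasDerivAt φ v u := by
    intro s hs
    obtain ⟨δ, hδ, hiso⟩ := h s hs
    obtain ⟨v, hv, hφ⟩ := exists_unit_direction_of_isometric hδ hiso
    refine ⟨v, hv, ?_⟩
    filter_upwards [ball_mem_nhds s hδ] with u hu
    have h1 : HasDerivAt (fun x : ℝ => φ s + (x - s) • v) v u := by
      simpa using (((hasDerivAt_id u).sub_const s).smul_const v).const_add (φ s)
    refine h1.congr_of_eventuallyEq ?_
    filter_upwards [isOpen_ball.mem_nhds hu] with x hx using hφ x hx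
  have hconst : ∀ s ∈ ball t η, deriv φ s = deriv φ a := by
    intro s hs
    have h0 : ∀ x ∈ ball t η, HasDerivAt (deriv φ) 0 x := by
      intro x hx
      obtain ⟨v, -, hv⟩ := key x hx
      exact (hasDerivAt_const x v).congr_of_eventuallyEq (hv.mono fun u hu => hu.deriv)
    exact isOpen_ball.is_const_of_deriv_eq_zero (convex_ball t η).isPreconnected
      (fun x hx => (h0 x hx).differentiableAt.differentiableWithinAt)
      (fun x hx => (h0 x hx).deriv) hs ha
  obtain ⟨v, hv1, hv⟩ := key a ha
  have hva : deriv φ a = v := hv.self_of_nhds.deriv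
  have hd : ∀ x ∈ ball t η, HasDerivAt (fun u : ℝ => φ u - u • v) 0 x := by
    intro x hx
    obtain ⟨w, -, hw⟩ := key x hx
    have hwv : w = v := by rw [← hw.self_of_nhds.deriv, hconst x hx, hva]
    have := hw.self_of_nhds.sub ((hasDerivAt_id x).smul_const v)
    rw [hwv, one_smul, sub_self] at this
    exact this
  have := isOpen_ball.is_const_of_deriv_eq_zero (convex_ball t η).isPreconnected
      (fun x hx => (hd x hx).differentiableAt.differentiableWithinAt)
      (fun x hx => (hd x hx).deriv) ha hb
  have h2 : φ a - φ b = (a - b) • v := by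
    rw [sub_smul, sub_eq_sub_iff_sub_eq_sub]
    exact this
  rw [dist_eq_norm, h2, norm_smul, hv1, mul_one, Real.norm_eq_abs]

variable {S : Type*} [MetricSpace S] {g h : ℝ → S}

lemma IsLocalGeodesicAt.exists_ball {t : ℝ} (hg : IsLocalGeodesicAt g t) :
    ∃ δ > 0, ∀ u ∈ ball t δ, ∀ w ∈ ball t δ, dist (g u) (g w) = |u - w| := by
  obtain ⟨δ, hδ, H⟩ := hg
  exact ⟨δ, hδ, fun u hu w hw => H u w hu hw⟩

lemma IsLocalGeodesic.continuous (hg : IsLocalGeodesic g) : Continuous g := by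
  rw [continuous_iff_continuousAt]
  intro t
  obtain ⟨δ, hδ, H⟩ := (hg t).exists_ball
  rw [ContinuousAt, tendsto_iff_dist_tendsto_zero]
  have h0 : Tendsto (fun u : ℝ => |u - t|) (𝓝 t) (𝓝 0) :=
    (Continuous.tendsto' (by fun_prop) _ _ (by simp))
  refine h0.congr' ?_
  filter_upwards [ball_mem_nhds t hδ] with u hu
  exact (H u hu t (mem_ball_self hδ)).symm

lemma IsLocalGeodesic.dist_le_of_le (hg : IsLocalGeodesic g) {a b : ℝ} (hab : a ≤ b) :
    dist (g a) (g b) ≤ b - a := by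
  have hc := hg.continuous
  have hcl : IsClosed ({t : ℝ | dist (g a) (g t) ≤ t - a} ∩ Icc a b) :=
    (isClosed_le (by fun_prop) (by fun_prop)).inter isClosed_Icc
  refine hcl.Icc_subset_of_forall_exists_gt (by simp) (fun x hx y hy => ?_) (right_mem_Icc.2 hab)
  obtain ⟨δ, hδ, H⟩ := (hg x).exists_ball
  have hxy : x < y := hy
  have hz : x < min y (x + δ / 2) := lt_min hxy (by linarith)
  refine ⟨min y (x + δ / 2), ?_, hz, min_le_left _ _⟩
  have hzb : min y (x + δ / 2) ∈ ball x δ := by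
    rw [mem_ball, Real.dist_eq, abs_of_pos (by linarith)]
    linarith [min_le_right y (x + δ / 2)]
  have h1 := H x (mem_ball_self hδ) _ hzb
  rw [abs_sub_comm, abs_of_pos (by linarith)] at h1
  have h2 : dist (g a) (g x) ≤ x - a := hx.1
  have h3 := dist_triangle (g a) (g x) (g (min y (x + δ / 2)))
  show dist (g a) (g (min y (x + δ / 2))) ≤ min y (x + δ / 2) - a
  linarith

lemma IsLocalGeodesic.dist_le (hg : IsLocalGeodesic g) (a b : ℝ) :
    dist (g a) (g b) ≤ |a - b| := by
  rcases le_total a b with hab | hab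
  · rw [abs_sub_comm, abs_of_nonneg (by linarith)]
    exact hg.dist_le_of_le hab
  · rw [dist_comm, abs_of_nonneg (by linarith)]
    exact hg.dist_le_of_le hab

/-- Reparametrizing by an isometry of the line preserves local geodesics. -/
lemma IsLocalGeodesic.comp_isometry (hg : IsLocalGeodesic g) {ρ : ℝ → ℝ} (hρ : Isometry ρ) :
    IsLocalGeodesic (fun t => g (ρ t)) := by
  intro t
  obtain ⟨δ, hδ, H⟩ := hg (ρ t)
  have hd : ∀ a b, |ρ a - ρ b| = |a - b| := fun a b => by
    simpa [Real.dist_eq] using hρ.dist_eq a b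
  refine ⟨δ, hδ, fun s u hs hu => ?_⟩
  rw [← hd] at hs hu ⊢
  exact H _ _ hs hu

lemma isometry_add_mul {σ : ℝ} (hσ : |σ| = 1) (s : ℝ) : Isometry (fun t : ℝ => s + σ * t) := by
  refine Isometry.of_dist_eq fun a b => ?_
  rw [Real.dist_eq, Real.dist_eq, add_sub_add_left_eq_sub, ← mul_sub, abs_mul, hσ, one_mul]

/-- Local geodesics through regular points which agree near one time agree everywhere. -/
lemma IsLocalGeodesic.eq_of_eventuallyEq (hg : IsLocalGeodesic g) (hh : IsLocalGeodesic h)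
    (hreg : ∀ t, IsRegularPoint (g t)) {t₀ : ℝ} (h₀ : g =ᶠ[𝓝 t₀] h) : g = h := by
  have hopen : IsOpen {t : ℝ | g =ᶠ[𝓝 t] h} := isOpen_setOfPred_eventually_nhds
  have hclosed : IsClosed {t : ℝ | g =ᶠ[𝓝 t] h} := by
    refine isClosed_of_closure_subset fun t ht => ?_
    have hgt : g t = h t :=
      closure_minimal (fun s (hs : g =ᶠ[𝓝 s] h) => hs.self_of_nhds)
        (isClosed_eq hg.continuous hh.continuous) ht
    obtain ⟨ε, hε, f, hf, -⟩ := hreg t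
    obtain ⟨δ₁, hδ₁, H₁⟩ := (hg t).exists_ball
    obtain ⟨δ₂, hδ₂, H₂⟩ := (hh t).exists_ball
    set δ := min ε (min δ₁ δ₂)
    have hδ : 0 < δ := lt_min hε (lt_min hδ₁ hδ₂)
    have hsub₁ : ball t δ ⊆ ball t δ₁ :=
      ball_subset_ball ((min_le_right _ _).trans (min_le_left _ _))
    have hsub₂ : ball t δ ⊆ ball t δ₂ :=
      ball_subset_ball ((min_le_right _ _).trans (min_le_right _ _))
    have hgb : ∀ u ∈ ball t δ, g u ∈ ball (g t) ε := fun u hu =>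
      lt_of_le_of_lt (hg.dist_le u t) (lt_of_lt_of_le hu (min_le_left _ _))
    have hhb : ∀ u ∈ ball t δ, h u ∈ ball (g t) ε := fun u hu => by
      rw [hgt]
      exact lt_of_le_of_lt (hh.dist_le u t) (lt_of_lt_of_le hu (min_le_left _ _))
    obtain ⟨v, -, hv⟩ := exists_unit_direction_of_isometric (φ := fun u => f (g u)) hδ
      fun s hs u hu => by
        rw [hf _ (hgb s hs) _ (hgb u hu), H₁ s (hsub₁ hs) u (hsub₁ hu)]
    obtain ⟨w, -, hw⟩ := exists_unit_direction_of_isometric (φ := fun u => f (h u)) hδ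
      fun s hs u hu => by
        rw [hf _ (hhb s hs) _ (hhb u hu), H₂ s (hsub₂ hs) u (hsub₂ hu)]
    obtain ⟨t₁, ht₁, ht₁'⟩ := mem_closure_iff_nhds.1 ht _ (ball_mem_nhds t hδ)
    have hev : ∀ᶠ u in 𝓝 t₁, g u = h u ∧ u ∈ ball t δ :=
      Filter.Eventually.and ht₁' (isOpen_ball.mem_nhds ht₁)
    obtain ⟨t₂, ⟨heq, ht₂⟩, hne⟩ : ∃ t₂, (g t₂ = h t₂ ∧ t₂ ∈ ball t δ) ∧ t₂ ≠ t := by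
      by_cases htt : t₁ = t
      · obtain ⟨t₂, h1, h2⟩ := ((hev.filter_mono nhdsWithin_le_nhds).and
          (self_mem_nhdsWithin : {t₁}ᶜ ∈ 𝓝[≠] t₁)).exists
        exact ⟨t₂, h1, by rw [← htt]; exact h2⟩
      · exact ⟨t₁, hev.self_of_nhds, htt⟩
    have hvw : v = w := by
      have h1 := hv t₂ ht₂
      have h2 := hw t₂ ht₂
      simp only [heq, hgt] at h1 h2
      rw [h1] at h2
      exact smul_right_injective _ (sub_ne_zero.2 hne) (add_left_cancel h2)
    show g =ᶠ[𝓝 t] h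
    filter_upwards [ball_mem_nhds t hδ] with u hu
    have h1 := hv u hu
    have h2 := hw u hu
    simp only [hgt, hvw] at h1 h2
    rw [← dist_eq_zero, ← hf _ (hgb u hu) _ (hhb u hu), h1, h2, dist_self]
  have huniv := IsClopen.eq_univ ⟨hclosed, hopen⟩ ⟨t₀, h₀⟩
  funext t
  have ht : g =ᶠ[𝓝 t] h := eq_univ_iff_forall.1 huniv t
  exact ht.self_of_nhds

/-- A local geodesic running for a while inside the image of another one overlaps with it. -/
lemma IsLocalGeodesic.exists_overlap (hg : IsLocalGeodesic g) (hh : IsLocalGeodesic h)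
    {C : Set ℝ} (hC : IsClosed C) {c r : ℝ} (hr : 0 < r)
    (hsub : ∀ u ∈ ball c r, h u ∈ g '' C) :
    ∃ c' ∈ ball c r, ∃ s ∈ C, ∃ σ : ℝ, |σ| = 1 ∧
      ∀ᶠ u in 𝓝 c', h u = g (s + σ * (u - c')) := by
  choose δ hδ hiso using fun t => (hg t).exists_ball
  obtain ⟨A, hA, hcov⟩ := TopologicalSpace.countable_cover_nhds
    (fun t => closedBall_mem_nhds t (half_pos (hδ t)))
  have := hA.to_subtype
  let F : Option A → Set ℝ := fun i =>
    i.elim (ball c r)ᶜ (fun a => h ⁻¹' (g '' (C ∩ closedBall (a : ℝ) (δ a / 2))))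
  have hF : ∀ i, IsClosed (F i) := by
    rintro (_ | a)
    · exact isOpen_ball.isClosed_compl
    · exact ((((isCompact_closedBall _ _).inter_left hC).image hg.continuous).isClosed).preimage
        hh.continuous
  have hU : ⋃ i, F i = univ := by
    refine eq_univ_of_forall fun u => mem_iUnion.2 ?_
    by_cases hu : u ∈ ball c r
    · obtain ⟨s, hs, hgs⟩ := hsub u hu
      have hs' : s ∈ ⋃ x ∈ A, closedBall x (δ x / 2) := hcov ▸ mem_univ s
      obtain ⟨a, ha, hsa⟩ := mem_iUnion₂.1 hs'
      exact ⟨some ⟨a, ha⟩, s, ⟨hs, hsa⟩, hgs⟩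
    · exact ⟨none, hu⟩
  obtain ⟨c', hc', hc''⟩ := (dense_iUnion_interior_of_closed hF hU).exists_mem_open
    isOpen_ball ⟨c, mem_ball_self hr⟩
  obtain ⟨i, hi⟩ := mem_iUnion.1 hc'
  rcases i with _ | a
  · exact absurd hc'' (interior_subset hi)
  obtain ⟨ρ, hρ, H⟩ := (hh c').exists_ball
  obtain ⟨ρ', hρ', hball⟩ := Metric.isOpen_iff.1 isOpen_interior c' hi
  have hmem : ∀ u ∈ ball c' (min ρ ρ'), ∃ s, s ∈ C ∧ s ∈ ball (a : ℝ) (δ a) ∧ g s = h u := by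
    intro u hu
    obtain ⟨s, ⟨hs, hsa⟩, hgs⟩ := interior_subset (hball (ball_subset_ball (min_le_right _ _) hu))
    exact ⟨s, hs, closedBall_subset_ball (half_lt_self (hδ a)) hsa, hgs⟩
  choose! τ hτC hτa hτ using hmem
  have hm : 0 < min ρ ρ' := lt_min hρ hρ'
  obtain ⟨σ, hσ, hτσ⟩ := exists_unit_direction_of_isometric (φ := τ) hm fun s hs u hu => by
    rw [Real.dist_eq, ← hiso a _ (hτa s hs) _ (hτa u hu), hτ s hs, hτ u hu]
    exact H s (ball_subset_ball (min_le_left _ _) hs) u (ball_subset_ball (min_le_left _ _) hu)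
  refine ⟨c', hc'', τ c', hτC c' (mem_ball_self hm), σ, hσ, ?_⟩
  filter_upwards [ball_mem_nhds c' hm] with u hu
  rw [← hτ u hu, hτσ u hu, smul_eq_mul, mul_comm]

/-- A pointwise limit of local geodesics is a local geodesic near any time at which the limit
is a regular point. -/
lemma isLocalGeodesicAt_of_tendsto {ι : Type*} {l : Filter ι} [l.NeBot] {γ : ι → ℝ → S}
    (hγ : ∀ i, IsLocalGeodesic (γ i)) (hlim : ∀ t, Tendsto (fun i => γ i t) l (𝓝 (h t)))
    {t : ℝ} (hreg : IsRegularPoint (h t)) : IsLocalGeodesicAt h t := by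
  obtain ⟨ε, hε, f, hf, -⟩ := hreg
  refine ⟨ε / 2, half_pos hε, fun s u hs hu => ?_⟩
  refine tendsto_nhds_unique ((hlim s).dist (hlim u)) (tendsto_const_nhds.congr' ?_)
  filter_upwards [(hlim t).eventually (ball_mem_nhds _ (half_pos hε))] with i hi
  have hb : ∀ w ∈ ball t (ε / 2), γ i w ∈ ball (h t) ε := by
    intro w hw
    have h1 := (hγ i).dist_le w t
    have h2 := dist_triangle (γ i w) (γ i t) (h t)
    rw [mem_ball, Real.dist_eq] at hw
    rw [mem_ball]
    linarith
  rw [← hf _ (hb s hs) _ (hb u hu)]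
  refine (dist_eq_of_locally_isometric (φ := fun w => f (γ i w)) (fun w hw => ?_) hs hu).symm
  obtain ⟨δ, hδ, H⟩ := (hγ i w).exists_ball
  obtain ⟨δ', hδ', hsub⟩ := Metric.isOpen_iff.1 isOpen_ball w hw
  refine ⟨min δ δ', lt_min hδ hδ', fun x hx y hy => ?_⟩
  rw [hf _ (hb x (hsub (ball_subset_ball (min_le_right _ _) hx))) _
    (hb y (hsub (ball_subset_ball (min_le_right _ _) hy)))]
  exact H x (ball_subset_ball (min_le_left _ _) hx) y (ball_subset_ball (min_le_left _ _) hy)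

/-- A local geodesic cannot fold back along itself. -/
lemma IsLocalGeodesic.not_reflected (hg : IsLocalGeodesic g) (m : ℝ) :
    ¬ ∀ w, g (m + w) = g (m - w) := by
  intro hw
  obtain ⟨δ, hδ, H⟩ := hg m
  have h1 := H (m + δ / 2) (m - δ / 2)
    (by rw [add_sub_cancel_left, abs_of_pos (by positivity)]; linarith)
    (by rw [sub_sub_cancel_left, abs_neg, abs_of_pos (by positivity)]; linarith)
  rw [hw, dist_self, add_sub_sub_cancel, abs_of_pos (by linarith)] at h1
  linarith

/-- If the image of a local geodesic through regular points is compact, then the geodesic keeps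
returning close to each of its points. -/
lemma IsLocalGeodesic.exists_recurrence [CompactSpace S] (hg : IsLocalGeodesic g)
    (hreg : ∀ t, IsRegularPoint (g t)) (hcl : IsClosed (range g)) (t₀ : ℝ) {V : Set S}
    (hV : V ∈ 𝓝 (g t₀)) (N : ℝ) : ∃ t > N, g t ∈ V := by
  let l : Ultrafilter ℕ := Filter.hyperfilter ℕ
  have hle : (l : Filter ℕ) ≤ atTop := Nat.hyperfilter_le_atTop
  have hlim : ∀ t : ℝ, ∃ y, Tendsto (fun k : ℕ => g (k + 1 * t)) l (𝓝 y) := by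
    intro t
    obtain ⟨y, -, hy⟩ := isCompact_univ.ultrafilter_le_nhds (l.map fun k : ℕ => g (k + 1 * t))
      (by simp)
    exact ⟨y, hy⟩
  choose h hlim using hlim
  have hrange : ∀ t, h t ∈ range g := fun t =>
    hcl.mem_of_tendsto (hlim t) (Eventually.of_forall fun k => mem_range_self _)
  have hh : IsLocalGeodesic h := fun t => by
    refine isLocalGeodesicAt_of_tendsto
      (fun k : ℕ => hg.comp_isometry (isometry_add_mul abs_one (k : ℝ))) hlim ?_
    obtain ⟨s, hs⟩ := hrange t
    exact hs ▸ hreg s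
  obtain ⟨c, -, s, -, σ, hσ, hev⟩ := hg.exists_overlap hh isClosed_univ (c := 0) one_pos
    fun u _ => by simpa using hrange u
  have hσσ : σ * σ = 1 := by rw [← abs_mul_abs_self, hσ, one_mul]
  have heq : (fun u => g ((s - σ * c) + σ * u)) = h := by
    refine (hg.comp_isometry (isometry_add_mul hσ _)).eq_of_eventuallyEq hh
      (fun u => hreg _) (t₀ := c) ?_
    filter_upwards [hev] with u hu
    rw [hu]
    ring_nf
  have ht₀ : h (c + σ * (t₀ - s)) = g t₀ := by
    rw [← heq]
    show g _ = g _
    congr 1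
    linear_combination (t₀ - s) * hσσ
  have hmem := (hlim (c + σ * (t₀ - s))).eventually (ht₀ ▸ hV)
  have hlarge : ∀ᶠ k : ℕ in l, N < k + 1 * (c + σ * (t₀ - s)) :=
    ((tendsto_atTop_add_const_right _ _ tendsto_natCast_atTop_atTop).mono_left hle).eventually
      (eventually_gt_atTop N)
  obtain ⟨k, hk, hkN⟩ := (hmem.and hlarge).exists
  exact ⟨_, hkN, hk⟩

theorem IsLocalGeodesic.exists_period [CompactSpace S] (hg : IsLocalGeodesic g)
    (hreg : ∀ t, IsRegularPoint (g t)) (hcl : IsClosed (range g)) :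
    ∃ T : ℝ, 0 < T ∧ Function.Periodic g T := by
  have : CompactSpace (range g) := isCompact_iff_compactSpace.1 hcl.isCompact
  have hne : Nonempty (range g) := ⟨g 0, mem_range_self 0⟩
  obtain ⟨n, ⟨x, hx⟩, hxn⟩ := nonempty_interior_of_iUnion_of_closed
    (f := fun n : ℕ => ((↑) : range g → S) ⁻¹' (g '' Icc (-(n : ℝ)) n))
    (fun n => ((isCompact_Icc.image hg.continuous).isClosed).preimage continuous_subtype_val)
    (by
      refine eq_univ_of_forall ?_
      rintro ⟨_, t, rfl⟩
      obtain ⟨n, hn⟩ := exists_nat_ge |t|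
      exact mem_iUnion.2 ⟨n, t, abs_le.1 hn, rfl⟩)
  rw [mem_interior_iff_mem_nhds, nhds_subtype_eq_comap, mem_comap] at hxn
  obtain ⟨V, hV, hVsub⟩ := hxn
  obtain ⟨t₀, rfl⟩ := hx
  obtain ⟨W, hWV, hWo, hW⟩ := _root_.mem_nhds_iff.1 hV
  obtain ⟨t, ht, htW⟩ := hg.exists_recurrence hreg hcl t₀ (hWo.mem_nhds hW) (n + 1)
  obtain ⟨r, hr, hrW⟩ := Metric.isOpen_iff.1 (hWo.preimage hg.continuous) t htW
  obtain ⟨c, hc, s, hs, σ, hσ, hev⟩ := hg.exists_overlap hg isClosed_Icc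
    (C := Icc (-(n : ℝ)) n) (c := t) (lt_min hr one_pos) fun u hu =>
      hVsub (a := ⟨g u, mem_range_self u⟩) (hWV (hrW (ball_subset_ball (min_le_left _ _) hu)))
  have hcn : n < c := by
    have : |c - t| < 1 := lt_of_lt_of_le hc (min_le_right _ _)
    linarith [(abs_lt.1 this).1]
  have heq : g = fun u => g ((s - σ * c) + σ * u) := by
    refine hg.eq_of_eventuallyEq (hg.comp_isometry (isometry_add_mul hσ _)) hreg (t₀ := c) ?_
    filter_upwards [hev] with u hu
    rw [hu]
    ring_nf
  rcases (abs_eq zero_le_one).1 hσ with rfl | rfl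
  · refine ⟨c - s, by linarith [hs.2], fun u => ?_⟩
    rw [congrFun heq (u + (c - s))]
    ring_nf
  · refine absurd (fun w => ?_) (hg.not_reflected ((s + c) / 2))
    rw [congrFun heq ((s + c) / 2 + w)]
    ring_nf

end LocalGeodesics

/-- a geodesic `g` in `S` containing no conical point is closed
(periodic) if and only if its image is a closed subset of `S`. -/
theorem closed_geodesic_iff_closed_image
    {S : Type*} [MetricSpace S] [CompactSpace S] [ConnectedSpace S]
    (E : ESCS S) (hbig : E.BigAngles)
    (g : ℝ → S) (hg : IsLocalGeodesic g) (hreg : ∀ t : ℝ, g t ∉ E.conePts) :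
    (∃ T : ℝ, 0 < T ∧ Function.Periodic g T) ↔ IsClosed (Set.range g) := by
  have hreg' : ∀ t, IsRegularPoint (g t) := fun t => E.regular _ (hreg t)
  refine ⟨?_, hg.exists_period hreg'⟩
  rintro ⟨T, hT, hper⟩
  exact (hper.compact_of_continuous hT.ne' hg.continuous).isClosed

end
end
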